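/- arXiv:1406.1386 — 8 statements merged into one kernel-verified Lean document; each statement's English description precedes it below -/
import Mathlib

section
/- Let n ≥ 2 and 0 < λ ≤ Λ. There exists ε₀ > 0, depending only on n, λ, Λ, with the following property: if a : ℝⁿ → (symmetric n×n real matrices) satisfies λ|ξ|² ≤ ξᵀa(x)ξ ≤ Λ|ξ|² for all x, ξ ∈ ℝⁿ, and u : ℝⁿ → ℝ is a twice continuously differentiable function with ∑_{i,j} a_{ij}(x) ∂ᵢ∂ⱼu(x) = 0 for all x ∈ ℝⁿ, and there exist C > 0 and δ ∈ (0, ε₀) such that |u(x)| ≤ C(1+|x|)^δ for all x ∈ ℝⁿ, then u is constant. -/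
open scoped BigOperators

noncomputable def hess {n : ℕ} (u : EuclideanSpace ℝ (Fin n) → ℝ)
    (x : EuclideanSpace ℝ (Fin n)) : Matrix (Fin n) (Fin n) ℝ :=
  Matrix.of fun i j =>
    iteratedFDeriv ℝ 2 u x ![EuclideanSpace.single i 1, EuclideanSpace.single j 1]


open MeasureTheory Metric Set

abbrev EE (n : ℕ) := EuclideanSpace ℝ (Fin n)

def Ell {n : ℕ} (lam Lam : ℝ) (a : Matrix (Fin n) (Fin n) ℝ) : Prop :=
  ∀ ξ : EE n, lam * ‖ξ‖ ^ 2 ≤ ∑ i, ∑ j, ξ i * a i j * ξ j ∧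
          ∑ i, ∑ j, ξ i * a i j * ξ j ≤ Lam * ‖ξ‖ ^ 2

def Sol {n : ℕ} (lam Lam : ℝ) (u : EE n → ℝ) : Prop :=
  ContDiff ℝ 2 u ∧ ∀ x, ∃ a : Matrix (Fin n) (Fin n) ℝ, Ell lam Lam a ∧
    ∑ i, ∑ j, a i j * hess u x i j = 0

lemma ell_diag {n : ℕ} {lam Lam : ℝ} {a : Matrix (Fin n) (Fin n) ℝ} (ha : Ell lam Lam a) (i : Fin n) :
    a i i ≤ Lam := by
  have h := (ha (EuclideanSpace.single i 1)).2
  simpa [Finset.sum_ite_eq, PiLp.single_apply] using h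

lemma ell_trace {n : ℕ} {lam Lam : ℝ} {a : Matrix (Fin n) (Fin n) ℝ} (ha : Ell lam Lam a) :
    ∑ i, a i i ≤ n * Lam := by
  calc ∑ i, a i i ≤ ∑ i : Fin n, Lam := Finset.sum_le_sum fun i _ => ell_diag ha i
    _ = n * Lam := by simp

lemma ell_psd {n : ℕ} {lam Lam : ℝ} {a B : Matrix (Fin n) (Fin n) ℝ} (ha : Ell lam Lam a)
    (hB : B.PosSemidef) : lam * B.trace ≤ ∑ i, ∑ j, a i j * B i j := by
  obtain ⟨m, v, rfl⟩ := Matrix.posSemidef_iff_eq_sum_vecMulVec.mp hB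
  have h1 : ∀ k, lam * ∑ i, v k i * v k i ≤ ∑ i, ∑ j, a i j * (v k i * v k j) := by
    intro k
    have h := (ha (WithLp.toLp 2 (v k))).1
    rw [EuclideanSpace.real_norm_sq_eq] at h
    simp only at h
    calc _ = lam * ∑ i, v k i ^ 2 := by simp only [sq]
      _ ≤ _ := h
      _ = _ := by
        refine Finset.sum_congr rfl fun i _ => Finset.sum_congr rfl fun j _ => by ring
  have h2 := Finset.sum_le_sum (s := Finset.univ) fun k _ => h1 k
  calc _ = ∑ k, lam * ∑ i, v k i * v k i := by
        simp only [Matrix.trace, Matrix.diag, Matrix.sum_apply, Matrix.vecMulVec_apply]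
        rw [Finset.sum_comm, Finset.mul_sum]
        simp
    _ ≤ _ := h2
    _ = _ := by
      rw [Finset.sum_comm]
      refine Finset.sum_congr rfl fun i _ => ?_
      rw [Finset.sum_comm]
      refine Finset.sum_congr rfl fun j _ => ?_
      simp [Matrix.sum_apply, Matrix.vecMulVec_apply, Finset.mul_sum]

lemma psd_det {n : ℕ} {B : Matrix (Fin n) (Fin n) ℝ} (hB : B.PosSemidef) {t : ℝ} (ht : B.trace ≤ t) :
    |B.det| ≤ t ^ n := by
  rw [abs_of_nonneg hB.det_nonneg, hB.1.det_eq_prod_eigenvalues]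
  have h := hB.1.trace_eq_sum_eigenvalues
  simp only [RCLike.ofReal_real_eq_id, id] at *
  calc _ ≤ ∏ i : Fin n, t := by
        refine Finset.prod_le_prod (fun i _ => hB.eigenvalues_nonneg i) fun i _ => ?_
        refine le_trans ?_ ht
        rw [h]
        exact Finset.single_le_sum (f := hB.1.eigenvalues) (fun i _ => hB.eigenvalues_nonneg i) (Finset.mem_univ i)
    _ = _ := by simp

lemma hess_apply {n : ℕ} (u : EE n → ℝ) (x : EE n) (i j : Fin n) :
    hess u x i j = fderiv ℝ (fderiv ℝ u) x (EuclideanSpace.single i 1) (EuclideanSpace.single j 1) := by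
  simp [hess, iteratedFDeriv_two_apply]

lemma eucl_sum {n : ℕ} (ξ : EE n) : ξ = ∑ i, ξ i • (EuclideanSpace.single i (1:ℝ) : EE n) := by
  have := (EuclideanSpace.basisFun (Fin n) ℝ).sum_repr ξ
  simpa using this.symm

lemma hess_quad {n : ℕ} (u : EE n → ℝ) (x ξ : EE n) :
    fderiv ℝ (fderiv ℝ u) x ξ ξ = ∑ i, ∑ j, ξ i * hess u x i j * ξ j := by
  conv_lhs => rw [eucl_sum ξ]
  simp only [map_sum, map_smul, sum_apply, smul_apply, smul_eq_mul, hess_apply]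
  simp only [Finset.mul_sum]
  rw [Finset.sum_comm]
  refine Finset.sum_congr rfl fun i _ => ?_
  refine Finset.sum_congr rfl fun j _ => by ring

lemma hess_symm {n : ℕ} {u : EE n → ℝ} (hu : ContDiff ℝ 2 u) (x : EE n) (i j : Fin n) :
    hess u x i j = hess u x j i := by
  rw [hess_apply, hess_apply]
  exact (hu.contDiffAt.isSymmSndFDerivAt (by simp)) _ _

lemma line_deriv1 {n : ℕ} {u : EE n → ℝ} (hu : ContDiff ℝ 2 u) (x ξ : EE n) (t : ℝ) :
    HasDerivAt (fun t : ℝ => u (x + t • ξ)) (fderiv ℝ u (x + t • ξ) ξ) t := by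
  have h1 : HasDerivAt (fun t : ℝ => x + t • ξ) ξ t := by
    simpa using ((hasDerivAt_id t).smul_const ξ).const_add x
  exact ((hu.differentiable (by simp)) _).hasFDerivAt.comp_hasDerivAt t h1

lemma line_deriv2 {n : ℕ} {u : EE n → ℝ} (hu : ContDiff ℝ 2 u) (x ξ : EE n) :
    HasDerivAt (fun t : ℝ => fderiv ℝ u (x + t • ξ) ξ) (fderiv ℝ (fderiv ℝ u) x ξ ξ) 0 := by
  have h1 : HasDerivAt (fun t : ℝ => x + t • ξ) ξ 0 := by
    simpa using ((hasDerivAt_id (0:ℝ)).smul_const ξ).const_add x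
  have h2 : Differentiable ℝ (fderiv ℝ u) :=
    (hu.fderiv_right (m := 1) (by norm_num)).differentiable (by simp)
  have h3 : HasFDerivAt (fderiv ℝ u) (fderiv ℝ (fderiv ℝ u) x) (x + (0:ℝ) • ξ) := by
    simpa using (h2 x).hasFDerivAt
  have h4 := h3.comp_hasDerivAt (0:ℝ) h1
  simpa using h4.clm_apply (hasDerivAt_const (0:ℝ) ξ)

lemma second_test {f f' : ℝ → ℝ} {c : ℝ} (h1 : ∀ t, HasDerivAt f (f' t) t)
    (h2 : HasDerivAt f' c 0) (hm : IsLocalMin f 0) : f' 0 = 0 ∧ 0 ≤ c := by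
  have e : deriv f = f' := funext fun t => (h1 t).deriv
  have h0 : f' 0 = 0 := hm.hasDerivAt_eq_zero (h1 0)
  refine ⟨h0, ?_⟩
  by_contra hc
  push Not at hc
  have hM : IsLocalMax f 0 := isLocalMax_of_deriv_deriv_neg (by rw [e, h2.deriv]; exact hc)
    (by rw [e]; exact h0) (h1 0).continuousAt
  have hconst : f =ᶠ[nhds 0] fun _ => f 0 := by
    filter_upwards [hm, hM] with t a b using le_antisymm b a
  have h3 : deriv f =ᶠ[nhds 0] deriv (fun _ => f 0) := hconst.deriv
  have h4 := h3.deriv_eq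
  rw [e, h2.deriv] at h4
  simp at h4
  linarith

/-- sum of hessian with quadratic perturbation is psd -/
lemma psd_of_quad {n : ℕ} {B : Matrix (Fin n) (Fin n) ℝ} (hs : ∀ i j, B i j = B j i)
    (h : ∀ ξ : EE n, 0 ≤ ∑ i, ∑ j, ξ i * B i j * ξ j) : B.PosSemidef := by
  refine Matrix.PosSemidef.of_dotProduct_mulVec_nonneg ?_ ?_
  · ext i j
    simpa using hs j i
  · intro v
    have := h (WithLp.toLp 2 v)
    refine this.trans_eq ?_; symm
    simp only [dotProduct, Matrix.mulVec, Finset.mul_sum, star_trivial]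
    refine Finset.sum_congr rfl fun i _ => Finset.sum_congr rfl fun j _ => by ring

lemma gen_test {n : ℕ} {u : EE n → ℝ} (hu : ContDiff ℝ 2 u) {F : EE n → ℝ} {z ξ : EE n}
    {f' : ℝ → ℝ} {c : ℝ} (h1 : ∀ t, HasDerivAt (fun t : ℝ => F (z + t • ξ)) (f' t) t)
    (h2 : HasDerivAt f' c 0) (hm : IsLocalMin (fun x => u x + F x) z) :
    fderiv ℝ u z ξ + f' 0 = 0 ∧ 0 ≤ fderiv ℝ (fderiv ℝ u) z ξ ξ + c := by
  have hm' : IsLocalMin (fun t : ℝ => u (z + t • ξ) + F (z + t • ξ)) 0 := by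
    have hc : ContinuousAt (fun t : ℝ => z + t • ξ) 0 := by fun_prop
    have : IsLocalMin (fun x => u x + F x) ((fun t : ℝ => z + t • ξ) 0) := by simpa using hm
    exact IsLocalMin.comp_continuous (g := fun t : ℝ => z + t • ξ) this hc
  have := second_test (fun t => (line_deriv1 hu z ξ t).add (h1 t)) ((line_deriv2 hu z ξ).add h2) hm'
  simpa using this

lemma norm_line {n : ℕ} (w ξ y : EE n) (t : ℝ) :
    ‖w + t • ξ - y‖ ^ 2 = ‖w - y‖ ^ 2 + 2 * inner ℝ (w - y) ξ * t + ‖ξ‖ ^ 2 * t ^ 2 := by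
  have : w + t • ξ - y = (w - y) + t • ξ := by abel
  rw [this, norm_add_sq_real, inner_smul_right, norm_smul, mul_pow, Real.norm_eq_abs, sq_abs]
  ring

lemma barrier_test {n : ℕ} {u : EE n → ℝ} (hu : ContDiff ℝ 2 u) {z y p : EE n} {k h b : ℝ}
    (hm : IsLocalMin (fun x => u x + (k / 2 * ‖x - y‖ ^ 2 - h * Real.exp (-b * ‖x - p‖ ^ 2))) z) (ξ : EE n) :
    0 ≤ fderiv ℝ (fderiv ℝ u) z ξ ξ +
      ((k + 2 * h * b * Real.exp (-b * ‖z - p‖ ^ 2)) * ‖ξ‖ ^ 2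
        - 4 * h * b ^ 2 * Real.exp (-b * ‖z - p‖ ^ 2) * (inner ℝ (z - p) ξ) ^ 2) := by
  set B := inner ℝ (z - y) ξ
  set B' := inner ℝ (z - p) ξ
  set C := ‖ξ‖ ^ 2
  have key : ∀ (A B : ℝ) (t : ℝ), HasDerivAt (fun t : ℝ => A + 2 * B * t + C * t ^ 2) (2 * B + 2 * C * t) t := by
    intro A B t
    have := (((hasDerivAt_id t).const_mul (2 * B)).const_add A).add ((hasDerivAt_pow 2 t).const_mul C)
    refine this.congr_deriv ?_
    simp; ring
  have lin : ∀ (B : ℝ), HasDerivAt (fun t : ℝ => 2 * B + 2 * C * t) (2 * C) 0 := by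
    intro B
    have := ((hasDerivAt_id (0:ℝ)).const_mul (2 * C)).const_add (2 * B)
    simpa using this
  have ex : ∀ t, HasDerivAt (fun t : ℝ => Real.exp (-b * (‖z - p‖ ^ 2 + 2 * B' * t + C * t ^ 2)))
      (Real.exp (-b * (‖z - p‖ ^ 2 + 2 * B' * t + C * t ^ 2)) * (-b * (2 * B' + 2 * C * t))) t := by
    intro t
    exact ((key (‖z - p‖ ^ 2) B' t).const_mul (-b)).exp
  refine (gen_test hu (ξ := ξ) (F := fun x => k / 2 * ‖x - y‖ ^ 2 - h * Real.exp (-b * ‖x - p‖ ^ 2))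
    (f' := fun t => k / 2 * (2 * B + 2 * C * t) - h * (Real.exp (-b * (‖z - p‖ ^ 2 + 2 * B' * t + C * t ^ 2)) * (-b * (2 * B' + 2 * C * t)))) ?_ ?_ hm).2
  · intro t
    simp only [norm_line]
    exact ((key _ B t).const_mul _).sub ((ex t).const_mul h)
  · have := ((lin B).const_mul (k / 2)).sub (((ex 0).mul ((lin B').const_mul (-b))).const_mul h)
    refine this.congr_deriv ?_
    simp
    ring

def Touch {n : ℕ} (u : EE n → ℝ) (K : ℝ) (z y : EE n) : Prop :=
  ∀ x, u z + K / 2 * ‖z - y‖ ^ 2 ≤ u x + K / 2 * ‖x - y‖ ^ 2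

lemma touch_test {n : ℕ} {u : EE n → ℝ} (hu : ContDiff ℝ 2 u) {K : ℝ} {z y : EE n}
    (h : Touch u K z y) (ξ : EE n) :
    fderiv ℝ u z ξ + K * inner ℝ (z - y) ξ = 0 ∧ 0 ≤ fderiv ℝ (fderiv ℝ u) z ξ ξ + K * ‖ξ‖ ^ 2 := by
  set B := inner ℝ (z - y) ξ
  set C := ‖ξ‖ ^ 2
  have key : ∀ (A B : ℝ) (t : ℝ), HasDerivAt (fun t : ℝ => A + 2 * B * t + C * t ^ 2) (2 * B + 2 * C * t) t := by
    intro A B t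
    have := (((hasDerivAt_id t).const_mul (2 * B)).const_add A).add ((hasDerivAt_pow 2 t).const_mul C)
    refine this.congr_deriv ?_
    simp; ring
  have lin : ∀ (B : ℝ), HasDerivAt (fun t : ℝ => 2 * B + 2 * C * t) (2 * C) 0 := by
    intro B
    have := ((hasDerivAt_id (0:ℝ)).const_mul (2 * C)).const_add (2 * B)
    simpa using this
  have := gen_test hu (ξ := ξ) (F := fun x => K / 2 * ‖x - y‖ ^ 2)
    (f' := fun t => K / 2 * (2 * B + 2 * C * t)) (c := K / 2 * (2 * C)) (z := z) ?_ ?_ ?_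
  · refine ⟨?_, ?_⟩
    · have := this.1
      simp at this
      linarith
    · have := this.2
      linarith
  · intro t
    simp only [norm_line]
    exact ((key _ B t).const_mul _)
  · exact (lin B).const_mul _
  · exact Filter.Eventually.of_forall h

lemma sum_id {n : ℕ} (ξ : EE n) : ∑ i, ∑ j, ξ i * (1 : Matrix (Fin n) (Fin n) ℝ) i j * ξ j = ‖ξ‖ ^ 2 := by
  rw [EuclideanSpace.real_norm_sq_eq]
  simp [Matrix.one_apply, sq]

lemma sum_rank {n : ℕ} (d ξ : EE n) : ∑ i, ∑ j, ξ i * (d i * d j) * ξ j = (inner ℝ d ξ) ^ 2 := by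
  rw [PiLp.inner_apply, sq, Finset.sum_mul_sum]
  refine Finset.sum_congr rfl fun i _ => Finset.sum_congr rfl fun j _ => ?_
  simp
  ring

lemma sol_ineq {n : ℕ} {lam Lam : ℝ} (hlam : 0 < lam) {u : EE n → ℝ} (hu : Sol lam Lam u) (x d : EE n)
    {c1 c2 : ℝ} (hc1 : 0 ≤ c1) (hc2 : 0 ≤ c2)
    (h : ∀ ξ, 0 ≤ fderiv ℝ (fderiv ℝ u) x ξ ξ + (c1 * ‖ξ‖ ^ 2 - c2 * (inner ℝ d ξ) ^ 2)) :
    c2 * (lam * ‖d‖ ^ 2) ≤ c1 * (n * Lam) := by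
  obtain ⟨a, ha, h0⟩ := hu.2 x
  let B : Matrix (Fin n) (Fin n) ℝ := fun i j => hess u x i j + (c1 * (1 : Matrix (Fin n) (Fin n) ℝ) i j - c2 * (d i * d j))
  have hB : B.PosSemidef := by
    apply psd_of_quad
    · intro i j
      simp only [B]
      rw [hess_symm hu.1 x i j, Matrix.one_apply, Matrix.one_apply]
      simp only [eq_comm]
      ring
    · intro ξ
      refine (h ξ).trans_eq ?_
      rw [hess_quad, ← sum_id, ← sum_rank]
      simp only [Finset.mul_sum, ← Finset.sum_sub_distrib, ← Finset.sum_add_distrib]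
      refine Finset.sum_congr rfl fun i _ => Finset.sum_congr rfl fun j _ => ?_
      simp only [B]
      ring
  have h1 := ell_psd ha hB
  have h2 : 0 ≤ lam * B.trace := mul_nonneg hlam.le hB.trace_nonneg
  have h3 : ∑ i, ∑ j, a i j * B i j = c1 * ∑ i, a i i - c2 * ∑ i, ∑ j, d i * a i j * d j := by
    have e1 : ∑ i, a i i = ∑ i, ∑ j, a i j * (1 : Matrix (Fin n) (Fin n) ℝ) i j := by
      simp [Matrix.one_apply]
    rw [e1, ← zero_add (c1 * _), ← h0]
    simp only [Finset.mul_sum, ← Finset.sum_sub_distrib, ← Finset.sum_add_distrib]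
    refine Finset.sum_congr rfl fun i _ => Finset.sum_congr rfl fun j _ => ?_
    simp only [B]
    ring
  have h4 := mul_le_mul_of_nonneg_left (ell_trace ha) hc1
  have h5 := mul_le_mul_of_nonneg_left (ha d).1 hc2
  linarith

noncomputable def TM {n : ℕ} (u : EE n → ℝ) (K : ℝ) (x : EE n) : EE n :=
  WithLp.toLp 2 (fun i => x i + K⁻¹ * fderiv ℝ u x (EuclideanSpace.single i 1))

noncomputable def TMd {n : ℕ} (u : EE n → ℝ) (K : ℝ) (x : EE n) : EE n →L[ℝ] EE n :=
  LinearMap.toContinuousLinearMap (Matrix.toEuclideanLin (1 + K⁻¹ • hess u x))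

lemma TM_hasFDerivAt {n : ℕ} {u : EE n → ℝ} (hu : ContDiff ℝ 2 u) (K : ℝ) (x : EE n) :
    HasFDerivAt (TM u K) (TMd u K x) x := by
  rw [← hasFDerivWithinAt_univ, hasFDerivWithinAt_euclidean]
  intro i
  rw [hasFDerivWithinAt_univ]
  have h2 : Differentiable ℝ (fderiv ℝ u) :=
    (hu.fderiv_right (m := 1) (by norm_num)).differentiable (by simp)
  have h3 : HasFDerivAt (fun x : EE n => x i + K⁻¹ * fderiv ℝ u x (EuclideanSpace.single i 1))
    (EuclideanSpace.proj i + K⁻¹ • ((fderiv ℝ (fderiv ℝ u) x).flip (EuclideanSpace.single i 1))) x := by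
    refine HasFDerivAt.add (EuclideanSpace.proj (𝕜 := ℝ) i).hasFDerivAt (HasFDerivAt.const_mul ?_ _)
    refine ((h2 x).hasFDerivAt.clm_apply (hasFDerivAt_const (EuclideanSpace.single i (1:ℝ)) x)).congr_fderiv ?_
    ext; simp
  refine h3.congr_fderiv ?_
  ext ξ
  have h4 : fderiv ℝ (fderiv ℝ u) x ξ (EuclideanSpace.single i 1) = ∑ j, hess u x i j * ξ j := by
    conv_lhs => rw [eucl_sum ξ]
    simp only [map_sum, map_smul, sum_apply, smul_apply, smul_eq_mul]
    refine Finset.sum_congr rfl fun j _ => ?_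
    rw [hess_symm hu, hess_apply]
    ring
  change ξ i + K⁻¹ * (fderiv ℝ (fderiv ℝ u) x ξ (EuclideanSpace.single i 1)) = (Matrix.mulVec (1 + K⁻¹ • hess u x) ξ.ofLp) i
  rw [h4, Matrix.add_mulVec, Matrix.one_mulVec, Matrix.smul_mulVec]
  rfl

lemma TM_det {n : ℕ} {lam Lam : ℝ} (hlam : 0 < lam) {u : EE n → ℝ} (hu : Sol lam Lam u) {K : ℝ} (hK : 0 < K) {x : EE n}
    (h : ∀ ξ, 0 ≤ fderiv ℝ (fderiv ℝ u) x ξ ξ + K * ‖ξ‖ ^ 2) :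
    |(TMd u K x).det| ≤ (n * Lam / lam) ^ n := by
  have : (TMd u K x).det = (1 + K⁻¹ • hess u x).det := by
    rw [TMd, LinearMap.det_toContinuousLinearMap]
    exact LinearMap.det_toLpLin 2 _
  rw [this]
  obtain ⟨a, ha, h0⟩ := hu.2 x
  have hB : (1 + K⁻¹ • hess u x).PosSemidef := by
    apply psd_of_quad
    · intro i j
      simp only [Matrix.add_apply, Matrix.smul_apply]
      rw [hess_symm hu.1 x i j, Matrix.one_apply, Matrix.one_apply]
      simp only [eq_comm]
    · intro ξ
      have h1 := mul_nonneg (inv_nonneg.2 hK.le) (h ξ)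
      refine h1.trans_eq ?_
      rw [mul_add, ← mul_assoc, inv_mul_cancel₀ hK.ne', one_mul, hess_quad, ← sum_id]
      simp only [Finset.mul_sum, ← Finset.sum_add_distrib]
      refine Finset.sum_congr rfl fun i _ => Finset.sum_congr rfl fun j _ => ?_
      simp only [Matrix.add_apply, Matrix.smul_apply, smul_eq_mul]
      ring
  apply psd_det hB
  rw [le_div_iff₀ hlam, mul_comm]
  refine (ell_psd ha hB).trans ?_
  refine le_trans (le_of_eq ?_) (ell_trace ha)
  have e1 : ∑ i, a i i = ∑ i, ∑ j, a i j * (1 : Matrix (Fin n) (Fin n) ℝ) i j := by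
    simp [Matrix.one_apply]
  rw [e1, ← add_zero (∑ i, ∑ j, a i j * (1 : Matrix (Fin n) (Fin n) ℝ) i j), ← mul_zero K⁻¹, ← h0]
  simp only [Finset.mul_sum, ← Finset.sum_add_distrib]
  refine Finset.sum_congr rfl fun i _ => Finset.sum_congr rfl fun j _ => ?_
  simp only [Matrix.add_apply, Matrix.smul_apply, smul_eq_mul]
  ring

lemma touch_TM {n : ℕ} {u : EE n → ℝ} (hu : ContDiff ℝ 2 u) {K : ℝ} (hK : 0 < K) {z y : EE n}
    (h : Touch u K z y) : TM u K z = y := by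
  ext i
  have := (touch_test hu h (EuclideanSpace.single i 1)).1
  simp [EuclideanSpace.inner_single_right] at this
  simp only [TM]
  have h2 : fderiv ℝ u z (EuclideanSpace.single i 1) = K * (y i - z i) := by linarith
  rw [h2, ← mul_assoc, inv_mul_cancel₀ hK.ne']
  ring

abbrev DD (n : ℕ) : Set (EE n) := closedBall (0 : EE n) 2

def AK {n : ℕ} (u : EE n → ℝ) (K : ℝ) : Set (EE n) :=
  {z | z ∈ DD n ∧ TM u K z ∈ DD n ∧ Touch u K z (TM u K z)}

lemma TM_cont {n : ℕ} {u : EE n → ℝ} (hu : ContDiff ℝ 2 u) (K : ℝ) : Continuous (TM u K) :=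
  continuous_iff_continuousAt.2 fun x => (TM_hasFDerivAt hu K x).continuousAt

lemma AK_closed {n : ℕ} {u : EE n → ℝ} (hu : ContDiff ℝ 2 u) (K : ℝ) : IsClosed (AK u K) := by
  have h1 := TM_cont hu K
  have h0 := hu.continuous
  have : AK u K = DD n ∩ ((TM u K) ⁻¹' (DD n) ∩
      ⋂ x, {z | u z + K / 2 * ‖z - TM u K z‖ ^ 2 ≤ u x + K / 2 * ‖x - TM u K z‖ ^ 2}) := by
    ext z
    simp [AK, Touch]
  rw [this]
  refine isClosed_closedBall.inter ((isClosed_closedBall.preimage h1).inter (isClosed_iInter fun x => ?_))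
  exact isClosed_le (by fun_prop) (by fun_prop)

lemma mem_AK {n : ℕ} {u : EE n → ℝ} (hu : ContDiff ℝ 2 u) {K : ℝ} (hK : 0 < K) {z y : EE n}
    (hz : z ∈ DD n) (hy : y ∈ DD n) (h : Touch u K z y) : z ∈ AK u K := by
  have := touch_TM hu hK h
  exact ⟨hz, by rwa [this], by rwa [this]⟩

lemma quad_diff {n : ℕ} (x y z : EE n) :
    ‖x - y‖ ^ 2 - ‖z - y‖ ^ 2 = ‖x - z‖ ^ 2 - 2 * inner ℝ (x - z) (y - z) := by
  have e : x - y = (x - z) - (y - z) := by abel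
  rw [e, norm_sub_sq_real (x - z) (y - z), norm_sub_rev z y]
  ring

lemma AK_mono {n : ℕ} {u : EE n → ℝ} (hu : ContDiff ℝ 2 u) {K K' : ℝ} (hK : 0 < K) (hKK : K ≤ K') :
    AK u K ⊆ AK u K' := by
  rintro z ⟨hz, hy, ht⟩
  set y := TM u K z
  have hK' : 0 < K' := hK.trans_le hKK
  have h01 : K / K' ≤ 1 := by rw [div_le_one hK']; exact hKK
  have hy' : z + (K / K') • (y - z) ∈ DD n :=
    (convex_closedBall (0 : EE n) 2).add_smul_sub_mem hz hy ⟨by positivity, h01⟩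
  refine mem_AK hu hK' hz hy' fun x => ?_
  have h1 := ht x
  have h2 := quad_diff x y z
  have h3 := quad_diff x (z + (K / K') • (y - z)) z
  rw [add_sub_cancel_left, inner_smul_right] at h3
  have h4 : K' * (K / K' * inner ℝ (x - z) (y - z)) = K * inner ℝ (x - z) (y - z) := by
    field_simp
  have h5 : K * ‖x - z‖ ^ 2 ≤ K' * ‖x - z‖ ^ 2 := by gcongr
  have h6 := congrArg (fun t => K * t) h2
  have h7 := congrArg (fun t => K' * t) h3
  nlinarith

lemma exists_touch {n : ℕ} {u : EE n → ℝ} (hu : Continuous u) {k K L : ℝ} (hk : 0 < k) (hK : 3 * k ≤ K)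
    {y0 : EE n} (hL : ∀ x, L ≤ u x + k / 2 * ‖x - y0‖ ^ 2) (y : EE n) : ∃ z, Touch u K z y := by
  have hc : Continuous (fun x => u x + K / 2 * ‖x - y‖ ^ 2) := by fun_prop
  refine hc.exists_forall_le ?_
  have h1 : Filter.Tendsto (fun x : EE n => ‖x - y‖) (Filter.cocompact _) Filter.atTop := by
    have := tendsto_norm_cocompact_atTop (E := EE n)
    exact this.comp (Homeomorph.subRight y).isClosedEmbedding.tendsto_cocompact
  have h2 : Filter.Tendsto (fun x : EE n => L - k * ‖y - y0‖ ^ 2 + k / 2 * ‖x - y‖ ^ 2) (Filter.cocompact _) Filter.atTop := by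
    refine Filter.tendsto_atTop_add_const_left _ _ (Filter.Tendsto.const_mul_atTop (by positivity) ?_)
    exact (Filter.tendsto_pow_atTop two_ne_zero).comp h1
  refine Filter.tendsto_atTop_mono (fun x => ?_) h2
  have h3 := hL x
  have h4 : ‖x - y0‖ ≤ ‖x - y‖ + ‖y - y0‖ := norm_sub_le_norm_sub_add_norm_sub _ _ _
  have h5 : ‖x - y0‖ ^ 2 ≤ 2 * ‖x - y‖ ^ 2 + 2 * ‖y - y0‖ ^ 2 := by
    nlinarith [norm_nonneg (x - y0), sq_nonneg (‖x - y‖ - ‖y - y0‖)]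
  have h6 : 3 * k * ‖x - y‖ ^ 2 ≤ K * ‖x - y‖ ^ 2 := by gcongr
  nlinarith

lemma barrier_step {n : ℕ} (hn : 2 ≤ n) {lam Lam : ℝ} (hlam : 0 < lam) (hL : lam ≤ Lam) :
    ∃ M : ℝ, 0 < M ∧ ∀ (u : EE n → ℝ), Sol lam Lam u → ∀ (k r : ℝ), 0 < k → 0 < r →
      ∀ z1 y1 p : EE n, Touch u k z1 y1 → ‖z1 - p‖ ≤ 10 * r →
      ∃ m, ‖m - p‖ ≤ r / 4 ∧ u m + k / 2 * ‖m - y1‖ ^ 2 ≤ u z1 + k / 2 * ‖z1 - y1‖ ^ 2 + M * k * r ^ 2 := by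
  have hn0 : (0:ℝ) < n := by exact_mod_cast (by omega : 0 < n)
  have hLam : 0 < Lam := hlam.trans_le hL
  set β := 12 * (n * Lam) / lam with hβ
  have hβ0 : 0 < β := by positivity
  refine ⟨2 * Real.exp (100 * β) / β, by positivity, ?_⟩
  intro u hu k r hk hr z1 y1 p ht hz
  set M := 2 * Real.exp (100 * β) / β with hM
  have hM0 : 0 < M := by positivity
  set b := β / r ^ 2 with hb
  have hb0 : 0 < b := by positivity
  set h := M * k * r ^ 2 with hh
  have hh0 : 0 < h := by positivity
  have hcu := hu.1.continuous
  have hc : Continuous (fun x => u x + (k / 2 * ‖x - y1‖ ^ 2 - h * Real.exp (-b * ‖x - p‖ ^ 2))) := by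
    fun_prop
  obtain ⟨m, hm, hmin⟩ := (isCompact_closedBall p (11 * r)).exists_isMinOn ⟨p, by simp; positivity⟩ hc.continuousOn
  have hz11 : z1 ∈ closedBall p (11 * r) := by
    rw [mem_closedBall, dist_eq_norm]; linarith
  have h1 : u m + (k / 2 * ‖m - y1‖ ^ 2 - h * Real.exp (-b * ‖m - p‖ ^ 2)) ≤
      u z1 + (k / 2 * ‖z1 - y1‖ ^ 2 - h * Real.exp (-b * ‖z1 - p‖ ^ 2)) := hmin hz11
  have h2 := ht m
  have hbr : b * (10 * r) ^ 2 = 100 * β := by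
    rw [hb]; field_simp; ring
  have h3 : Real.exp (-(100 * β)) ≤ Real.exp (-b * ‖z1 - p‖ ^ 2) := by
    apply Real.exp_le_exp.2
    have : b * ‖z1 - p‖ ^ 2 ≤ b * (10 * r) ^ 2 := by gcongr
    linarith
  have h4 : h * Real.exp (-(100 * β)) ≤ h * Real.exp (-b * ‖z1 - p‖ ^ 2) := by gcongr
  have h5 : Real.exp (-(100 * β)) ≤ Real.exp (-b * ‖m - p‖ ^ 2) := by
    have : h * Real.exp (-(100 * β)) ≤ h * Real.exp (-b * ‖m - p‖ ^ 2) := by linarith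
    exact le_of_mul_le_mul_left this hh0
  have h6 : b * ‖m - p‖ ^ 2 ≤ b * (10 * r) ^ 2 := by
    have := Real.exp_le_exp.1 h5
    linarith
  have h7 : ‖m - p‖ ≤ 10 * r := by
    have := le_of_mul_le_mul_left h6 hb0
    exact le_of_sq_le_sq this (by positivity)
  have h8 : Real.exp (-b * ‖m - p‖ ^ 2) ≤ 1 := by
    rw [Real.exp_le_one_iff]
    have : 0 ≤ b * ‖m - p‖ ^ 2 := by positivity
    linarith
  refine ⟨m, ?_, ?_⟩
  swap
  · have h9 : h * Real.exp (-b * ‖m - p‖ ^ 2) ≤ h * 1 := by gcongr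
    have h10 : 0 ≤ h * Real.exp (-b * ‖z1 - p‖ ^ 2) := by positivity
    linarith
  by_contra hcon
  push Not at hcon
  have hloc : IsLocalMin (fun x => u x + (k / 2 * ‖x - y1‖ ^ 2 - h * Real.exp (-b * ‖x - p‖ ^ 2))) m := by
    refine hmin.isLocalMin ?_
    refine Filter.mem_of_superset (isOpen_ball.mem_nhds (x := m) (s := ball p (11 * r)) ?_) ball_subset_closedBall
    rw [mem_ball, dist_eq_norm]; linarith
  set E := Real.exp (-b * ‖m - p‖ ^ 2) with hE
  have hE0 : 0 < E := Real.exp_pos _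
  have h11 := sol_ineq hlam hu m (m - p) (c1 := k + 2 * h * b * E) (c2 := 4 * h * b ^ 2 * E)
    (by positivity) (by positivity) (barrier_test hu.1 hloc)
  have h12 : r ^ 2 / 16 ≤ ‖m - p‖ ^ 2 := by nlinarith
  have h13 : 4 * h * b ^ 2 * E * (lam * (r ^ 2 / 16)) ≤ 4 * h * b ^ 2 * E * (lam * ‖m - p‖ ^ 2) := by gcongr
  have h14 : 4 * h * b ^ 2 * E * (lam * (r ^ 2 / 16)) = h * b * E * (3 * (n * Lam)) := by
    have : b * (lam * r ^ 2) = 12 * (n * Lam) := by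
      rw [hb, hβ]; field_simp
    linear_combination (h * b * E / 4) * this
  have h15 : h * b * E * (n * Lam) ≤ k * (n * Lam) := by linarith
  have h16 : h * b * E ≤ k := le_of_mul_le_mul_right h15 (by positivity)
  have h17 : h * b * Real.exp (-(100 * β)) = 2 * k := by
    have e1 : Real.exp (100 * β) * Real.exp (-(100 * β)) = 1 := by rw [← Real.exp_add]; simp
    have e2 : h * b = 2 * Real.exp (100 * β) * k := by
      rw [hh, hb, hM]; field_simp
    rw [e2]
    linear_combination 2 * k * e1
  have h18 : h * b * Real.exp (-(100 * β)) ≤ h * b * E := by gcongr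
  linarith

lemma comb_id {n : ℕ} (x y' e : EE n) (N : ℝ) :
    ‖x - (y' + N • e)‖ ^ 2 + N * ‖x - (y' - e)‖ ^ 2 = (1 + N) * ‖x - y'‖ ^ 2 + (N ^ 2 + N) * ‖e‖ ^ 2 := by
  have e1 : x - (y' + N • e) = (x - y') - N • e := by abel
  have e2 : x - (y' - e) = (x - y') + e := by abel
  rw [e1, e2, norm_sub_sq_real, norm_add_sq_real, inner_smul_right, norm_smul, mul_pow, Real.norm_eq_abs, sq_abs]
  ring

lemma measure_step {n : ℕ} (hn : 2 ≤ n) {lam Lam : ℝ} (hlam : 0 < lam) (hL : lam ≤ Lam) :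
    ∃ N : ℝ, 1 ≤ N ∧ ∃ Q : NNReal, ∀ (u : EE n → ℝ), Sol lam Lam u → ∀ (k r : ℝ), 0 < k → 0 < r →
      ∀ p : EE n, closedBall p r ⊆ DD n → (AK u k ∩ closedBall p (10 * r)).Nonempty →
      volume (closedBall p r) ≤ Q * volume (AK u (N * k) ∩ closedBall p r) := by
  obtain ⟨M, hM, hstep⟩ := barrier_step hn hlam hL
  set N := 64 * M + 2 with hN
  have hN0 : 2 ≤ N := by linarith
  refine ⟨1 + N, by linarith, (16 : NNReal) ^ n * Real.toNNReal ((n * Lam / lam) ^ n), ?_⟩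
  rintro u hu k r hk hr p hp ⟨z1, hz1, hz1p⟩
  rw [mem_closedBall, dist_eq_norm] at hz1p
  obtain ⟨hz1D, hy1D, ht⟩ := hz1
  set y1 := TM u k z1
  obtain ⟨m, hmp, hm⟩ := hstep u hu k r hk hr z1 y1 p ht hz1p
  set K := (1 + N) * k with hK
  have hK0 : 0 < K := by positivity
  set S := AK u K ∩ closedBall p r
  have hSc : IsClosed S := (AK_closed hu.1 K).inter isClosed_closedBall
  set c0 : EE n := (1 + N)⁻¹ • (y1 + N • m) with hc0
  have hsub : closedBall c0 (r / 16) ⊆ TM u K '' S := by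
    intro y' hy'
    rw [mem_closedBall, dist_eq_norm] at hy'
    obtain ⟨z, hz⟩ := exists_touch hu.1.continuous (K := K) hk (by rw [hK]; nlinarith) ht y'
    set e : EE n := N⁻¹ • (y1 - y') with he
    have hNe : y1 = y' + N • e := by
      rw [he, smul_smul, mul_inv_cancel₀ (by linarith), one_smul]; abel
    set y : EE n := y' - e with hy
    have hym : ‖y - m‖ ≤ r / 8 := by
      have : y - m = ((1 + N) / N) • (y' - c0) := by
        rw [hy, he, hc0]
        have hNn : N ≠ 0 := by linarith
        have hNn' : (1 + N) ≠ 0 := by linarith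
        rw [smul_sub ((1 + N) / N), smul_smul, div_mul_eq_mul_div, mul_inv_cancel₀ hNn', smul_add, smul_smul, one_div, inv_mul_cancel₀ hNn, add_div, div_self hNn, add_smul, smul_sub, one_smul, one_div, one_smul]
        abel
      rw [this, norm_smul, Real.norm_eq_abs, abs_of_pos (by positivity)]
      have h2 : (1 + N) / N ≤ 2 := by
        rw [div_le_iff₀ (by linarith)]; linarith
      calc (1 + N) / N * ‖y' - c0‖ ≤ 2 * (r / 16) := by gcongr
        _ = r / 8 := by ring
    have hyD : y ∈ DD n := by
      apply hp
      rw [mem_closedBall, dist_eq_norm]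
      have := norm_sub_le_norm_sub_add_norm_sub y m p
      linarith
    have hy'D : y' ∈ DD n := by
      have h1 : y' = y + (1 / (1 + N)) • (y1 - y) := by
        have : y1 - y = (1 + N) • e := by
          rw [hNe, hy, add_smul 1 N, one_smul]; abel
        rw [this, smul_smul, one_div, inv_mul_cancel₀ (by linarith), one_smul, hy]; abel
      rw [h1]
      refine (convex_closedBall (0 : EE n) 2).add_smul_sub_mem hyD hy1D ⟨by positivity, ?_⟩
      rw [div_le_one (by linarith)]; linarith
    have hzy : ‖z - y‖ ≤ r / 4 := by
      have i1 := comb_id z y' e N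
      have i2 := comb_id m y' e N
      rw [← hNe, ← hy] at i1 i2
      have i3 := hz m
      have i4 := ht z
      have i5 : ‖m - y‖ ^ 2 ≤ (r / 8) ^ 2 := by
        rw [norm_sub_rev]; gcongr
      have j1 : K / 2 * ‖z - y'‖ ^ 2 = k / 2 * (‖z - y1‖ ^ 2 + N * ‖z - y‖ ^ 2) - k / 2 * ((N ^ 2 + N) * ‖e‖ ^ 2) := by
        rw [i1, hK]; ring
      have j2 : K / 2 * ‖m - y'‖ ^ 2 = k / 2 * (‖m - y1‖ ^ 2 + N * ‖m - y‖ ^ 2) - k / 2 * ((N ^ 2 + N) * ‖e‖ ^ 2) := by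
        rw [i2, hK]; ring
      have j3 : k * N / 2 * ‖m - y‖ ^ 2 ≤ k * N / 2 * (r / 8) ^ 2 := by gcongr
      have j4 : k * (N / 2 * ‖z - y‖ ^ 2) ≤ k * (M * r ^ 2 + N / 2 * (r / 8) ^ 2) := by
        linarith
      have j5 := le_of_mul_le_mul_left j4 hk
      have j6 : M * r ^ 2 ≤ N / 64 * r ^ 2 := by
        gcongr
        rw [hN]; linarith
      have j7 : N * ‖z - y‖ ^ 2 ≤ N * (r / 4) ^ 2 := by
        have : 0 ≤ N * r ^ 2 := by positivity
        linarith
      exact le_of_sq_le_sq (le_of_mul_le_mul_left j7 (by linarith)) (by positivity)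
    have hzp : z ∈ closedBall p r := by
      rw [mem_closedBall, dist_eq_norm]
      have a1 := norm_sub_le_norm_sub_add_norm_sub z y p
      have a2 := norm_sub_le_norm_sub_add_norm_sub y m p
      linarith
    exact ⟨z, ⟨mem_AK hu.1 hK0 (hp hzp) hy'D hz, hzp⟩, touch_TM hu.1 hK0 hz⟩
  have hvol : volume (closedBall c0 (r / 16)) ≤ Real.toNNReal ((n * Lam / lam) ^ n) * volume S := by
    refine (measure_mono hsub).trans ?_
    refine (addHaar_image_le_lintegral_abs_det_fderiv volume hSc.measurableSet
      (fun x _ => (TM_hasFDerivAt hu.1 K x).hasFDerivWithinAt)).trans ?_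
    refine (setLIntegral_mono measurable_const (g := fun _ => ENNReal.ofReal ((n * Lam / lam) ^ n)) ?_).trans ?_
    · intro x hx
      exact ENNReal.ofReal_le_ofReal (TM_det hlam hu hK0 fun ξ => (touch_test hu.1 hx.1.2.2 ξ).2)
    · rw [setLIntegral_const]; rfl
  have hs : volume (closedBall p r) = (16 : NNReal) ^ n * volume (closedBall c0 (r / 16)) := by
    rw [Measure.addHaar_closedBall _ _ hr.le, Measure.addHaar_closedBall _ _ (by positivity), ← mul_assoc]
    congr 1
    simp only [finrank_euclideanSpace, Fintype.card_fin]
    have : ((16 : NNReal) : ENNReal) ^ n = ENNReal.ofReal (16 ^ n) := by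
      rw [ENNReal.ofReal_pow (by norm_num)]; norm_num
    rw [this, ← ENNReal.ofReal_mul (by positivity), ← mul_pow]
    congr 2
    ring
  rw [hs, ENNReal.coe_mul, ENNReal.coe_pow, mul_assoc]
  gcongr

lemma decay_step {n : ℕ} (hn : 2 ≤ n) {lam Lam : ℝ} (hlam : 0 < lam) (hL : lam ≤ Lam) :
    ∃ N : ℝ, 1 ≤ N ∧ ∃ θ : ℝ, 0 ≤ θ ∧ θ < 1 ∧ ∀ (u : EE n → ℝ), Sol lam Lam u → ∀ k : ℝ, 0 < k →
      (AK u k).Nonempty → volume.real (DD n \ AK u (N * k)) ≤ θ * volume.real (DD n \ AK u k) := by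
  obtain ⟨N, hN, Q, hstep⟩ := measure_step hn hlam hL
  set P : NNReal := (20 : NNReal) ^ n * Q with hP
  have hP0 : (0:ℝ) ≤ P := P.2
  refine ⟨N, hN, P / (P + 1), by positivity, by rw [div_lt_one (by positivity)]; linarith, ?_⟩
  intro u hu k hk hne
  set A := AK u k
  set A' := AK u (N * k)
  have hAc : IsClosed A := AK_closed hu.1 k
  have hAc' : IsClosed A' := AK_closed hu.1 (N * k)
  have hAA : A ⊆ A' := AK_mono hu.1 hk (by nlinarith)
  have hAD : A ⊆ DD n := fun z hz => hz.1
  set t := DD n \ A with ht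
  set d : EE n → ℝ := fun x => infDist x A with hd
  have hdpos : ∀ x ∈ t, 0 < d x := fun x hx => (hAc.notMem_iff_infDist_pos hne).1 hx.2
  have hd4 : ∀ x ∈ t, d x ≤ 4 := by
    intro x hx
    obtain ⟨a, ha⟩ := hne
    have h1 : d x ≤ dist x a := infDist_le_dist_of_mem ha
    have h2 := hx.1
    have h3 := hAD ha
    rw [mem_closedBall] at h2 h3
    have := dist_triangle_right x a 0
    linarith
  obtain ⟨v, hvt, hvd, hvc⟩ := Vitali.exists_disjoint_subfamily_covering_enlargement_closedBall t
    (fun x => x) (fun x => d x / 2) 2 (fun x hx => by have := hd4 x hx; linarith) 5 (by norm_num)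
  have hvcount : v.Countable := by
    refine hvd.countable_of_nonempty_interior fun x hx => ?_
    have := hdpos x (hvt hx)
    exact ⟨x, ball_subset_interior_closedBall (mem_ball_self (by positivity))⟩
  set c : EE n → EE n := fun x => (1 - d x / 8) • x with hc
  have hcn : ∀ x ∈ t, ‖x - c x‖ ≤ d x / 4 := by
    intro x hx
    have h0 := hdpos x hx
    have h2 := hx.1
    rw [mem_closedBall, dist_zero_right] at h2
    have : x - c x = (d x / 8) • x := by simp only [hc]; rw [sub_smul, one_smul]; abel
    rw [this, norm_smul, Real.norm_eq_abs, abs_of_pos (by positivity)]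
    nlinarith
  have hcD : ∀ x ∈ t, closedBall (c x) (d x / 8) ⊆ DD n := by
    intro x hx y hy
    have h0 := hdpos x hx
    have h4 := hd4 x hx
    have h2 := hx.1
    rw [mem_closedBall, dist_zero_right] at h2 ⊢
    rw [mem_closedBall, dist_eq_norm] at hy
    have h5 : ‖c x‖ ≤ (1 - d x / 8) * 2 := by
      simp only [hc]
      rw [norm_smul, Real.norm_eq_abs, abs_of_pos (by linarith)]
      gcongr
      linarith
    have h6 : ‖y‖ ≤ ‖y - c x‖ + ‖c x‖ := by
      have := norm_add_le (y - c x) (c x)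
      simpa using this
    linarith
  have hcB : ∀ x ∈ t, closedBall (c x) (d x / 8) ⊆ closedBall x (d x / 2) := by
    intro x hx
    apply closedBall_subset_closedBall'
    have := hcn x hx
    have h0 := hdpos x hx
    rw [dist_comm, dist_eq_norm]
    linarith
  have hct : ∀ x ∈ t, closedBall (c x) (d x / 8) ⊆ t := by
    intro x hx y hy
    refine ⟨hcD x hx hy, fun hyA => ?_⟩
    have h1 := hcB x hx hy
    rw [mem_closedBall, dist_comm] at h1
    have h2 : d x ≤ dist x y := infDist_le_dist_of_mem hyA
    have h0 := hdpos x hx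
    linarith
  have hmeas : ∀ x ∈ t, volume (closedBall x (5 * (d x / 2))) ≤ P * volume (A' ∩ closedBall (c x) (d x / 8)) := by
    intro x hx
    have h0 := hdpos x hx
    have h1 : volume (closedBall x (5 * (d x / 2))) = (20 : NNReal) ^ n * volume (closedBall (c x) (d x / 8)) := by
      rw [Measure.addHaar_closedBall _ _ (by positivity), Measure.addHaar_closedBall _ _ (by positivity), ← mul_assoc]
      congr 1
      simp only [finrank_euclideanSpace, Fintype.card_fin]
      have : ((20 : NNReal) : ENNReal) ^ n = ENNReal.ofReal (20 ^ n) := by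
        rw [ENNReal.ofReal_pow (by norm_num)]; norm_num
      rw [this, ← ENNReal.ofReal_mul (by positivity), ← mul_pow]
      congr 2
      ring
    rw [h1, hP, ENNReal.coe_mul, ENNReal.coe_pow, mul_assoc]
    gcongr
    refine hstep u hu k (d x / 8) hk (by positivity) (c x) (hcD x hx) ?_
    obtain ⟨a, ha, hda⟩ := hAc.exists_infDist_eq_dist hne x
    refine ⟨a, ha, ?_⟩
    rw [mem_closedBall]
    have h2 := dist_triangle_left a (c x) x
    have h3 := hcn x hx
    rw [← dist_eq_norm] at h3
    have h5 : d x = dist x a := hda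
    linarith
  have hcov : t ⊆ ⋃ x ∈ v, closedBall x (5 * (d x / 2)) := by
    intro x hx
    obtain ⟨b, hb, hsub⟩ := hvc x hx
    have h0 := hdpos x hx
    exact mem_biUnion hb (hsub (mem_closedBall_self (by positivity)))
  have hmain : volume t ≤ P * volume (t ∩ A') := by
    calc volume t ≤ ∑' x : v, volume (closedBall (x : EE n) (5 * (d x / 2))) :=
          (measure_mono hcov).trans (measure_biUnion_le _ hvcount _)
      _ ≤ ∑' x : v, P * volume (A' ∩ closedBall (c x) (d x / 8)) :=
          ENNReal.tsum_le_tsum fun x => hmeas x (hvt x.2)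
      _ = P * volume (⋃ x ∈ v, A' ∩ closedBall (c x) (d x / 8)) := by
          rw [ENNReal.tsum_mul_left, measure_biUnion hvcount]
          · intro x hx y hy hxy
            exact (hvd hx hy hxy).mono (inter_subset_right.trans (hcB x (hvt hx)))
              (inter_subset_right.trans (hcB y (hvt hy)))
          · intro x _
            exact (hAc'.inter isClosed_closedBall).measurableSet
      _ ≤ _ := by
          gcongr
          refine iUnion₂_subset fun x hx y hy => ⟨hct x (hvt hx) hy.2, hy.1⟩
  have hDfin : volume (DD n) ≠ ⊤ := measure_closedBall_lt_top.ne
  have htfin : volume t ≠ ⊤ := measure_ne_top_of_subset sdiff_subset hDfin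
  have hsplit := measureReal_inter_add_sdiff (μ := volume) (s := t) hAc'.measurableSet htfin
  have hreal : volume.real t ≤ P * volume.real (t ∩ A') := by
    have h2 : volume (t ∩ A') ≠ ⊤ := measure_ne_top_of_subset inter_subset_left htfin
    have := ENNReal.toReal_mono (ENNReal.mul_ne_top ENNReal.coe_ne_top h2) hmain
    rw [ENNReal.toReal_mul] at this
    exact this
  have heq : t \ A' = DD n \ A' := by
    rw [ht, sdiff_sdiff, union_eq_self_of_subset_left hAA]
  rw [heq] at hsplit
  have hi : 0 ≤ volume.real (t ∩ A') := measureReal_nonneg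
  rw [div_mul_eq_mul_div, le_div_iff₀ (by positivity)]
  nlinarith

lemma main_lemma {n : ℕ} (hn : 2 ≤ n) {lam Lam : ℝ} (hlam : 0 < lam) (hL : lam ≤ Lam) :
    ∃ μ : ℝ, 0 < μ ∧ ∀ (u : EE n → ℝ), Sol lam Lam u → (∀ x, -μ * (1 + ‖x‖ ^ 2) ≤ u x) →
      ∀ x0 : EE n, ‖x0‖ ≤ 1 → u x0 ≤ 0 →
      volume.real {x ∈ closedBall (0 : EE n) 1 | 1 / 2 ≤ u x} < 1 / 2 * volume.real (closedBall (0 : EE n) 1) := by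
  obtain ⟨N, hN, θ, hθ0, hθ1, hdec⟩ := decay_step hn hlam hL
  have hB : 0 < volume.real (closedBall (0 : EE n) 1) :=
    ENNReal.toReal_pos (measure_closedBall_pos _ _ one_pos).ne' measure_closedBall_lt_top.ne
  have hDp : 0 < volume.real (DD n) :=
    ENNReal.toReal_pos (measure_closedBall_pos _ _ two_pos).ne' measure_closedBall_lt_top.ne
  obtain ⟨m, hm⟩ := exists_pow_lt_of_lt_one (x := 1 / 2 * volume.real (closedBall (0 : EE n) 1) / volume.real (DD n))
    (by positivity) hθ1
  rw [lt_div_iff₀ hDp] at hm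
  have hNm : 0 < N ^ m := by positivity
  refine ⟨1 / (100 * N ^ m), by positivity, ?_⟩
  set μ := 1 / (100 * N ^ m) with hμ
  have hμ0 : 0 < μ := by positivity
  intro u hu hlow x0 hx0 hux0
  have hfin : volume (DD n) ≠ ⊤ := measure_closedBall_lt_top.ne
  have hx0D : x0 ∈ DD n := by rw [mem_closedBall, dist_zero_right]; linarith
  have hne : (AK u (10 * μ)).Nonempty := by
    obtain ⟨z, hz⟩ := exists_touch hu.1.continuous (k := 2 * μ) (K := 10 * μ) (L := -μ) (y0 := 0)
      (by positivity) (by linarith) (fun x => by have := hlow x; rw [sub_zero]; linarith) x0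
    have h1 := hz x0
    have h2 := hlow z
    rw [sub_self, norm_zero] at h1
    have h3 : ‖z‖ ≤ ‖z - x0‖ + ‖x0‖ := by
      have := norm_add_le (z - x0) x0
      simpa using this
    have h4 : ‖z‖ ≤ ‖z - x0‖ + 1 := by linarith
    have h5 : ‖z‖ ^ 2 ≤ 2 * ‖z - x0‖ ^ 2 + 2 := by
      nlinarith [norm_nonneg z, sq_nonneg (‖z - x0‖ - 1)]
    have h6 : μ * ‖z‖ ^ 2 ≤ μ * (2 * ‖z - x0‖ ^ 2 + 2) := by gcongr
    have h7 : μ * ‖z - x0‖ ^ 2 ≤ μ * 1 ^ 2 := by linarith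
    have h8 : ‖z - x0‖ ≤ 1 := le_of_sq_le_sq (le_of_mul_le_mul_left h7 hμ0) (by norm_num)
    refine ⟨z, mem_AK hu.1 (by positivity) ?_ hx0D hz⟩
    rw [mem_closedBall, dist_zero_right]; linarith
  have hind : ∀ j : ℕ, (AK u (N ^ j * (10 * μ))).Nonempty ∧
      volume.real (DD n \ AK u (N ^ j * (10 * μ))) ≤ θ ^ j * volume.real (DD n) := by
    intro j
    induction j with
    | zero =>
      rw [pow_zero, one_mul, pow_zero, one_mul]
      exact ⟨hne, measureReal_mono sdiff_subset hfin⟩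
    | succ j ih =>
      have hk : 0 < N ^ j * (10 * μ) := by positivity
      have e : N ^ (j + 1) * (10 * μ) = N * (N ^ j * (10 * μ)) := by ring
      rw [e]
      refine ⟨ih.1.mono (AK_mono hu.1 hk (by nlinarith)), ?_⟩
      refine (hdec u hu _ hk ih.1).trans ?_
      rw [pow_succ', mul_assoc]
      exact mul_le_mul_of_nonneg_left ih.2 hθ0
  refine lt_of_le_of_lt ?_ (lt_of_le_of_lt (hind m).2 hm)
  refine measureReal_mono ?_ (measure_ne_top_of_subset sdiff_subset hfin)
  rintro x ⟨hx, hux⟩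
  refine ⟨closedBall_subset_closedBall (by norm_num) hx, fun hxA => ?_⟩
  obtain ⟨_, hy, ht⟩ := hxA
  set K := N ^ m * (10 * μ) with hK
  have hKv : K = 1 / 10 := by rw [hK, hμ]; field_simp; norm_num
  have h1 := ht x0
  set y := TM u K x
  rw [mem_closedBall, dist_zero_right] at hy
  have h2 : ‖x0 - y‖ ≤ 3 := (norm_sub_le _ _).trans (by linarith)
  have h3 : ‖x0 - y‖ ^ 2 ≤ 3 ^ 2 := by gcongr
  rw [hKv] at h1
  have h4 : 0 ≤ ‖x - y‖ ^ 2 := by positivity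
  linarith

lemma sol_affine {n : ℕ} {lam Lam : ℝ} {u : EE n → ℝ} (hu : Sol lam Lam u) (α R β : ℝ) :
    Sol lam Lam (fun x => α * u (R • x) + β) := by
  have hd : Differentiable ℝ u := hu.1.differentiable (by simp)
  have h2 : Differentiable ℝ (fderiv ℝ u) :=
    (hu.1.fderiv_right (m := 1) (by norm_num)).differentiable (by simp)
  have hc := hu.1
  refine ⟨by fun_prop, fun x => ?_⟩
  obtain ⟨a, ha, h0⟩ := hu.2 (R • x)
  refine ⟨a, ha, ?_⟩
  have e1 : fderiv ℝ (fun x => α * u (R • x) + β) = fun x => (α * R) • fderiv ℝ u (R • x) := by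
    funext x
    rw [fderiv_add_const, fderiv_const_mul (by fun_prop), fderiv_comp_smul (f := u), smul_smul]
  have e2 : fderiv ℝ (fderiv ℝ (fun x => α * u (R • x) + β)) x = (α * R * R) • fderiv ℝ (fderiv ℝ u) (R • x) := by
    have h3 : DifferentiableAt ℝ (fun y => fderiv ℝ u (R • y)) x :=
      (h2 (R • x)).comp x (by fun_prop)
    have h4 := fderiv_fun_const_smul h3 (α * R)
    rw [fderiv_comp_smul (f := fderiv ℝ u), smul_smul] at h4
    rw [e1]
    exact h4
  have e3 : ∀ i j, hess (fun x => α * u (R • x) + β) x i j = (α * R * R) * hess u (R • x) i j := by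
    intro i j
    rw [hess_apply, hess_apply, e2]
    simp
  calc _ = (α * R * R) * ∑ i, ∑ j, a i j * hess u (R • x) i j := by
        simp only [e3, Finset.mul_sum]
        refine Finset.sum_congr rfl fun i _ => Finset.sum_congr rfl fun j _ => by ring
    _ = 0 := by rw [h0, mul_zero]

theorem liouville_slow_growth
    (n : ℕ) (hn : 2 ≤ n) (lam Lam : ℝ) (hlam : 0 < lam) (hlamLam : lam ≤ Lam) :
    ∃ ε₀ : ℝ, 0 < ε₀ ∧
      ∀ (A : EuclideanSpace ℝ (Fin n) → Matrix (Fin n) (Fin n) ℝ)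
        (u : EuclideanSpace ℝ (Fin n) → ℝ) (C δ : ℝ),
        (∀ x, (A x).IsSymm) →
        (∀ x (ξ : EuclideanSpace ℝ (Fin n)),
          lam * ‖ξ‖ ^ 2 ≤ ∑ i, ∑ j, ξ i * A x i j * ξ j ∧
          ∑ i, ∑ j, ξ i * A x i j * ξ j ≤ Lam * ‖ξ‖ ^ 2) →
        ContDiff ℝ 2 u →
        (∀ x, ∑ i, ∑ j, A x i j * hess u x i j = 0) →
        0 < C → 0 < δ → δ < ε₀ →
        (∀ x, |u x| ≤ C * (1 + ‖x‖) ^ δ) →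
        ∃ c : ℝ, ∀ x, u x = c := by
  obtain ⟨μ, hμ, hmain⟩ := main_lemma hn hlam hlamLam
  set p := min (μ / 4) 1 with hp
  have hp0 : 0 < p := by positivity
  have hp1 : p ≤ 1 := min_le_right _ _
  have hpμ : p ≤ μ / 4 := min_le_left _ _
  set η := min (μ / 2) 1 with hη
  have hη0 : 0 < η := by positivity
  have hη1 : η ≤ 1 := min_le_right _ _
  have hημ : η ≤ μ / 2 := min_le_left _ _
  refine ⟨p, hp0, ?_⟩
  intro A u C δ _ hA hu hAu hC hδ hδp hgrow
  have hsol : Sol lam Lam u := ⟨hu, fun x => ⟨A x, hA x, hAu x⟩⟩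
  by_contra hnc
  -- the weight
  set ρ : EE n × EE n → ℝ := fun q => max 1 (max ‖q.1‖ ‖q.2‖) with hρ
  have hρ1 : ∀ q, 1 ≤ ρ q := fun q => le_max_left _ _
  have hρp : ∀ q, 0 < ρ q ^ p := fun q => Real.rpow_pos_of_pos (by linarith [hρ1 q]) _
  set f : EE n × EE n → ℝ := fun q => (u q.1 - u q.2) / ρ q ^ p with hf
  have hub : ∀ (q : EE n × EE n) (x : EE n), ‖x‖ ≤ ρ q → |u x| ≤ C * (2 ^ p * ρ q ^ p) := by
    intro q x hx
    have h1 := hρ1 q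
    refine (hgrow x).trans ?_
    rw [← Real.mul_rpow (by norm_num) (by linarith)]
    gcongr
    calc (1 + ‖x‖) ^ δ ≤ (2 * ρ q) ^ δ := by
          gcongr
          linarith
      _ ≤ (2 * ρ q) ^ p := Real.rpow_le_rpow_of_exponent_le (by linarith) hδp.le
  have hbdd : BddAbove (range f) := by
    refine ⟨2 * C * 2 ^ p, ?_⟩
    rintro _ ⟨q, rfl⟩
    simp only [hf]
    rw [div_le_iff₀ (hρp q)]
    have h1 := (abs_le.1 (hub q q.1 ((le_max_left _ _).trans (le_max_right _ _)))).2
    have h2 := (abs_le.1 (hub q q.2 ((le_max_right _ _).trans (le_max_right _ _)))).1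
    linarith
  set S := sSup (range f) with hS
  have hfS : ∀ q, u q.1 - u q.2 ≤ S * ρ q ^ p := by
    intro q
    have : f q ≤ S := le_csSup hbdd ⟨q, rfl⟩
    simp only [hf] at this
    rwa [div_le_iff₀ (hρp q)] at this
  have hSpos : 0 < S := by
    push Not at hnc
    obtain ⟨x, hx⟩ := hnc (u 0)
    rcases lt_or_gt_of_ne hx with h | h
    · have h1 := hfS (0, x)
      have h2 := hρp (0, x)
      simp only at h1
      by_contra h3
      push Not at h3
      nlinarith
    · have h1 := hfS (x, 0)
      have h2 := hρp (x, 0)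
      simp only at h1
      by_contra h3
      push Not at h3
      nlinarith
  obtain ⟨_, ⟨q, rfl⟩, hq⟩ := exists_lt_of_lt_csSup (range_nonempty f)
    (show S / (1 + η) < sSup (range f) from by
      rw [div_lt_iff₀ (by linarith), ← hS]; nlinarith)
  set R := ρ q with hR
  have hR1 : 1 ≤ R := hρ1 q
  have hRp : 0 < R ^ p := hρp q
  simp only [hf] at hq
  rw [div_lt_div_iff₀ (by linarith) (hρp q), ← hR] at hq
  have hne : (closedBall (0 : EE n) R).Nonempty := ⟨0, by simp; linarith⟩
  obtain ⟨a, ha, hamin⟩ := (isCompact_closedBall (0 : EE n) R).exists_isMinOn hne hu.continuous.continuousOn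
  obtain ⟨b, hb, hbmax⟩ := (isCompact_closedBall (0 : EE n) R).exists_isMaxOn hne hu.continuous.continuousOn
  have hq1 : q.1 ∈ closedBall (0 : EE n) R := by
    rw [mem_closedBall, dist_zero_right]; exact (le_max_left _ _).trans (le_max_right _ _)
  have hq2 : q.2 ∈ closedBall (0 : EE n) R := by
    rw [mem_closedBall, dist_zero_right]; exact (le_max_right _ _).trans (le_max_right _ _)
  have hb1 : u q.1 ≤ u b := hbmax hq1
  have ha1 : u a ≤ u q.2 := hamin hq2
  rw [mem_closedBall, dist_zero_right] at ha hb
  set ω := u b - u a with hω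
  have hωS : S * R ^ p ≤ (1 + η) * ω := by
    have : (u q.1 - u q.2) * (1 + η) ≤ ω * (1 + η) := by
      gcongr
      linarith
    linarith
  have hω0 : 0 < ω := by
    have : 0 < S * R ^ p := by positivity
    by_contra h
    push Not at h
    nlinarith
  -- growth control
  have hctrl : ∀ (x y z : EE n), ‖y‖ ≤ max 1 ‖x‖ * R → ‖z‖ ≤ max 1 ‖x‖ * R →
      (u y - u z) / ω ≤ 1 + μ * (1 + ‖x‖ ^ 2) := by
    intro x y z hy hz
    set s := max 1 ‖x‖ with hs
    have hs1 : 1 ≤ s := le_max_left _ _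
    have hsx : s ≤ 1 + ‖x‖ := max_le (by linarith [norm_nonneg x]) (by linarith)
    have h1 := hfS (y, z)
    simp only at h1
    have h2 : ρ (y, z) ≤ s * R := max_le (by nlinarith) (max_le hy hz)
    have h3 : ρ (y, z) ^ p ≤ s ^ p * R ^ p := by
      rw [← Real.mul_rpow (by linarith) (by linarith)]
      have := hρ1 (y, z)
      gcongr
    have h4 : s ^ p ≤ 1 + p * ‖x‖ := by
      calc s ^ p ≤ (1 + ‖x‖) ^ p := by gcongr
        _ ≤ 1 + p * ‖x‖ := by
          apply rpow_one_add_le_one_add_mul_self _ hp0.le hp1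
          linarith [norm_nonneg x]
    have hsp : 0 ≤ s ^ p := by positivity
    have h5 : u y - u z ≤ s ^ p * ((1 + η) * ω) := by
      calc u y - u z ≤ S * (s ^ p * R ^ p) := h1.trans (by gcongr)
        _ = s ^ p * (S * R ^ p) := by ring
        _ ≤ _ := by gcongr
    rw [div_le_iff₀ hω0]
    refine h5.trans ?_
    rw [← mul_assoc]
    gcongr
    calc s ^ p * (1 + η) ≤ (1 + p * ‖x‖) * (1 + η) := by gcongr
      _ = 1 + η + (1 + η) * (p * ‖x‖) := by ring
      _ ≤ 1 + μ / 2 + (1 + 1) * (μ / 4 * ‖x‖) := by gcongr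
      _ ≤ _ := by nlinarith [sq_nonneg (‖x‖ - 1), norm_nonneg x]
  have hRx : ∀ x : EE n, ‖R • x‖ ≤ max 1 ‖x‖ * R := by
    intro x
    rw [norm_smul, Real.norm_eq_abs, abs_of_pos (by linarith), mul_comm]
    gcongr
    exact le_max_right _ _
  have hRle : ∀ (x y : EE n), ‖y‖ ≤ R → ‖y‖ ≤ max 1 ‖x‖ * R := by
    intro x y hy
    have : 1 ≤ max 1 ‖x‖ := le_max_left _ _
    nlinarith
  have hinv : ∀ y : EE n, R • (R⁻¹ • y) = y := fun y => by
    rw [smul_smul, mul_inv_cancel₀ (by linarith), one_smul]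
  have hinvn : ∀ y : EE n, ‖y‖ ≤ R → ‖R⁻¹ • y‖ ≤ 1 := fun y hy => by
    rw [norm_smul, Real.norm_eq_abs, abs_of_pos (by positivity), inv_mul_le_iff₀ (by linarith)]
    linarith
  have hv1 := hmain (fun x => ω⁻¹ * u (R • x) + (-(u a) / ω)) (sol_affine hsol _ _ _) (by
    intro x
    have h1 := hctrl x b (R • x) (hRle x b hb) (hRx x)
    have h2 : (u b - u (R • x)) / ω = 1 - (ω⁻¹ * u (R • x) + (-(u a) / ω)) := by
      have : u b = ω + u a := by rw [hω]; ring
      rw [this]; field_simp; ring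
    linarith) (R⁻¹ • a) (hinvn a ha) (by
      simp only [hinv]
      apply le_of_eq; field_simp; ring)
  have hv2 := hmain (fun x => (-ω⁻¹) * u (R • x) + (u b / ω)) (sol_affine hsol _ _ _) (by
    intro x
    have h1 := hctrl x (R • x) a (hRx x) (hRle x a ha)
    have h2 : (u (R • x) - u a) / ω = 1 - (-ω⁻¹ * u (R • x) + (u b / ω)) := by
      have : u b = ω + u a := by rw [hω]; ring
      rw [this]; field_simp; ring
    linarith) (R⁻¹ • b) (hinvn b hb) (by
      simp only [hinv]
      apply le_of_eq; field_simp; ring)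
  have hcover : closedBall (0 : EE n) 1 ⊆
      {x ∈ closedBall (0 : EE n) 1 | 1 / 2 ≤ ω⁻¹ * u (R • x) + (-(u a) / ω)} ∪
      {x ∈ closedBall (0 : EE n) 1 | 1 / 2 ≤ (-ω⁻¹) * u (R • x) + (u b / ω)} := by
    intro x hx
    have hsum : ω⁻¹ * u (R • x) + (-(u a) / ω) + ((-ω⁻¹) * u (R • x) + (u b / ω)) = 1 := by
      have : u b = ω + u a := by rw [hω]; ring
      rw [this]; field_simp; ring
    by_cases h : 1 / 2 ≤ ω⁻¹ * u (R • x) + (-(u a) / ω)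
    · exact Or.inl ⟨hx, h⟩
    · exact Or.inr ⟨hx, by push Not at h; linarith⟩
  have hfin : volume (closedBall (0 : EE n) 1) ≠ ⊤ := measure_closedBall_lt_top.ne
  have h1 := measureReal_mono (μ := volume) hcover
    (measure_ne_top_of_subset (union_subset (sep_subset _ _) (sep_subset _ _)) hfin)
  have h2 := h1.trans (measureReal_union_le _ _)
  linarith
end

section
/- Let n ≥ 3 and let f : [0,∞) → ℝ be continuous with f(t) > 0 for all t and f(t) = 1 for t ∈ [0,1]. Define u : ℝⁿ → ℝ by u(x) = n^{1/n} ∫₀^{|x|} ( ∫₀^{s} t^{n−1} f(t) dt )^{1/n} ds. Then u is convex, twice continuously differentiable on ℝⁿ, and det(D²u(x)) = f(|x|) for all x ∈ ℝⁿ. -/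
open MeasureTheory intervalIntegral

theorem det_aux {n : ℕ} (hn : 1 ≤ n) (a b : ℝ) (ha : a ≠ 0) (x : Fin n → ℝ) :
    (Matrix.of fun i j => a * (if i = j then 1 else 0) + b * (x i * x j)).det
      = a ^ (n - 1) * (a + b * ∑ i, x i ^ 2) := by
  have h : (Matrix.of fun i j => a * (if i = j then (1:ℝ) else 0) + b * (x i * x j))
      = a • (1 + Matrix.replicateCol Unit (fun i => b / a * x i) * Matrix.replicateRow Unit x) := by
    ext i j
    simp [Matrix.mul_apply, Matrix.one_apply]
    split_ifs <;> field_simp <;> ring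
  rw [h, Matrix.det_smul, Matrix.det_one_add_replicateCol_mul_replicateRow]
  obtain ⟨m, rfl⟩ : ∃ m, n = m + 1 := ⟨n - 1, by omega⟩
  have h2 : x ⬝ᵥ (fun i => b / a * x i) = b / a * ∑ i, x i ^ 2 := by
    simp only [dotProduct, Finset.mul_sum]
    exact Finset.sum_congr rfl fun i _ => by ring
  rw [h2]
  simp only [Fintype.card_fin, Nat.add_sub_cancel, pow_succ]
  field_simp

theorem radial_aux {n : ℕ} (hn : 1 ≤ n) (ψ a b : ℝ → ℝ)
    (hψ : ∀ w, HasDerivAt ψ (a w / 2) w) (ha : ∀ w, HasDerivAt a (b w) w)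
    (hb : Continuous b) (ha0 : ∀ w, a w ≠ 0)
    (u : EuclideanSpace ℝ (Fin n) → ℝ) (hu : ∀ x, u x = ψ (‖x‖ ^ 2)) :
    ContDiff ℝ 2 u ∧ ∀ x, (hess u x).det
      = a (‖x‖ ^ 2) ^ (n - 1) * (a (‖x‖ ^ 2) + 2 * b (‖x‖ ^ 2) * ‖x‖ ^ 2) := by
  have hu' : u = fun x => ψ (‖x‖ ^ 2) := funext hu
  have hda : deriv a = b := funext fun w => (ha w).deriv
  have hdψ : deriv ψ = fun w => a w / 2 := funext fun w => (hψ w).deriv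
  have ha1 : ContDiff ℝ 1 a :=
    contDiff_one_iff_deriv.2 ⟨fun w => (ha w).differentiableAt, by rw [hda]; exact hb⟩
  have hψ2 : ContDiff ℝ 2 ψ := by
    rw [show (2 : WithTop ℕ∞) = 1 + 1 from by norm_num, contDiff_succ_iff_deriv]
    refine ⟨fun w => (hψ w).differentiableAt, by simp, ?_⟩
    rw [hdψ]; exact ha1.div_const 2
  have hfd : fderiv ℝ u = fun x => a (‖x‖ ^ 2) • innerSL ℝ x := by
    funext x
    have h1 := (hψ (‖x‖ ^ 2)).comp_hasFDerivAt x (hasStrictFDerivAt_norm_sq x).hasFDerivAt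
    rw [hu']
    refine h1.fderiv.trans ?_
    ext v
    simp
    ring
  refine ⟨by rw [hu']; exact hψ2.comp (contDiff_norm_sq ℝ), fun x => ?_⟩
  have h2 : HasFDerivAt (fun x : EuclideanSpace ℝ (Fin n) => a (‖x‖ ^ 2) • innerSL ℝ x) _ x :=
    ((ha (‖x‖ ^ 2)).comp_hasFDerivAt x (hasStrictFDerivAt_norm_sq x).hasFDerivAt).smul
      (innerSL ℝ : EuclideanSpace ℝ (Fin n) →L[ℝ] _).hasFDerivAt
  have hh : hess u x = Matrix.of fun i j => a (‖x‖ ^ 2) * (if i = j then 1 else 0)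
      + (2 * b (‖x‖ ^ 2)) * (x i * x j) := by
    ext i j
    simp only [hess, Matrix.of_apply, iteratedFDeriv_two_apply, hfd]
    rw [h2.fderiv]
    have hij : ((innerSL ℝ) (EuclideanSpace.single i (1:ℝ))) (EuclideanSpace.single j (1:ℝ))
        = if i = j then 1 else 0 := by
      rw [innerSL_apply_apply, EuclideanSpace.inner_single_left]
      simp [Pi.single_apply]
    simp [hij, EuclideanSpace.inner_single_right]
    ring
  rw [hh, det_aux hn _ _ (ha0 _), EuclideanSpace.norm_sq_eq]
  simp

/-- Everything about the one-dimensional profile. -/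
theorem profile_aux (n : ℕ) (hn : 3 ≤ n) (F : ℝ → ℝ) (hF : Continuous F)
    (hpos : ∀ t, 0 < F t) (hone : ∀ t, t ≤ 1 → F t = 1) (g φ : ℝ → ℝ)
    (hg : ∀ s, g s = (n:ℝ) ^ ((1:ℝ)/n) * (∫ t in (0:ℝ)..s, t ^ (n-1) * F t) ^ ((1:ℝ)/n))
    (hφ : ∀ r, φ r = ∫ s in (0:ℝ)..r, g s) :
    Continuous g ∧ (∀ s, 0 < s → 0 < g s) ∧ (∀ s, 0 ≤ s → s ≤ 1 → g s = s) ∧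
    (∀ s, 0 < s → HasDerivAt g (s ^ (n-1) * F s / g s ^ (n-1)) s) ∧
    (∀ s, HasDerivAt φ (g s) s) ∧ (∀ s, 0 ≤ s → s ≤ 1 → φ s = s ^ 2 / 2) := by
  have hn0 : n ≠ 0 := by omega
  have hnR : (0:ℝ) < n := by exact_mod_cast Nat.pos_of_ne_zero hn0
  have hp : (0:ℝ) ≤ 1 / n := by positivity
  have hk : Continuous fun t : ℝ => t ^ (n-1) * F t := by fun_prop
  set G : ℝ → ℝ := fun s => ∫ t in (0:ℝ)..s, t ^ (n-1) * F t with hG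
  have hGd : ∀ s, HasDerivAt G (s ^ (n-1) * F s) s := fun s =>
    hk.integral_hasStrictDerivAt 0 s |>.hasDerivAt
  have hGc : Continuous G := continuous_iff_continuousAt.2 fun s => (hGd s).continuousAt
  have hGpos : ∀ s, 0 < s → 0 < G s := fun s hs =>
    intervalIntegral.intervalIntegral_pos_of_pos_on (hk.intervalIntegrable _ _)
      (fun t ht => mul_pos (pow_pos ht.1 _) (hpos t)) hs
  have hgG : g = fun s => (n:ℝ) ^ ((1:ℝ)/n) * (G s) ^ ((1:ℝ)/n) := funext hg
  have hgc : Continuous g := by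
    rw [hgG]
    exact continuous_const.mul (hGc.rpow_const fun _ => Or.inr hp)
  have hgpos : ∀ s, 0 < s → 0 < g s := fun s hs => by
    rw [hgG]
    have := hGpos s hs
    positivity
  have hgone : ∀ s, 0 ≤ s → s ≤ 1 → g s = s := fun s h0 h1 => by
    have : G s = s ^ n / n := by
      have e : G s = ∫ t in (0:ℝ)..s, t ^ (n-1) := by
        refine intervalIntegral.integral_congr fun t ht => ?_
        rw [Set.uIcc_of_le h0] at ht
        simp [hone t (ht.2.trans h1)]
      rw [e, integral_pow, Nat.sub_add_cancel (by omega)]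
      have : ((n - 1 : ℕ) : ℝ) + 1 = n := by
        rw [Nat.cast_sub (by omega)]; simp
      rw [this]; simp [hn0]
    simp only [hgG, this]
    rw [← Real.mul_rpow (by positivity) (by positivity), mul_div_cancel₀ _ hnR.ne', one_div,
      Real.pow_rpow_inv_natCast h0 hn0]
  have hφd : ∀ s, HasDerivAt φ (g s) s := fun s => by
    rw [show φ = fun r => ∫ s in (0:ℝ)..r, g s from funext hφ]
    exact hgc.integral_hasStrictDerivAt 0 s |>.hasDerivAt
  refine ⟨hgc, hgpos, hgone, fun s hs => ?_, hφd, fun s h0 h1 => ?_⟩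
  · have hGs := hGpos s hs
    have h1 : HasDerivAt g _ s :=
      hgG ▸ ((hGd s).rpow_const (p := (1:ℝ)/n) (Or.inl hGs.ne')).const_mul ((n:ℝ) ^ ((1:ℝ)/n))
    convert h1 using 1
    have hgn : g s ^ n = n * G s := by
      simp only [hgG]
      rw [← Real.mul_rpow hnR.le hGs.le, one_div, Real.rpow_inv_natCast_pow (by positivity) hn0]
    have hgs := hgpos s hs
    rw [Real.rpow_sub_one hGs.ne']
    have h3 : g s = (n:ℝ) ^ ((1:ℝ)/n) * (G s) ^ ((1:ℝ)/n) := hg s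
    have h4 : g s ^ n = g s ^ (n-1) * g s := by
      rw [← pow_succ, Nat.sub_add_cancel (by omega)]
    have h5 : (n:ℝ) ^ ((1:ℝ)/n) * (s ^ (n-1) * F s * (1 / n) * ((G s) ^ ((1:ℝ)/n) / G s))
        = s ^ (n-1) * F s * g s / (n * G s) := by
      rw [h3]; field_simp
    rw [h5, ← hgn, h4]
    field_simp
  · rw [hφ]
    have e : ∫ t in (0:ℝ)..s, g t = ∫ t in (0:ℝ)..s, t := by
      refine intervalIntegral.integral_congr fun t ht => ?_
      rw [Set.uIcc_of_le h0] at ht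
      exact hgone t ht.1 (ht.2.trans h1)
    rw [e, integral_id]; simp

theorem radial_monge_ampere_solution
    (n : ℕ) (hn : 3 ≤ n) (f : ℝ → ℝ)
    (hf_cont : ContinuousOn f (Set.Ici (0:ℝ)))
    (hf_pos : ∀ t, 0 ≤ t → 0 < f t)
    (hf_one : ∀ t ∈ Set.Icc (0:ℝ) 1, f t = 1)
    (u : EuclideanSpace ℝ (Fin n) → ℝ)
    (hu : ∀ x, u x = (n:ℝ) ^ ((1:ℝ)/n) *
      ∫ s in (0:ℝ)..‖x‖, (∫ t in (0:ℝ)..s, t ^ (n-1) * f t) ^ ((1:ℝ)/n)) :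
    ConvexOn ℝ Set.univ u ∧ ContDiff ℝ 2 u ∧ ∀ x, (hess u x).det = f ‖x‖ := by
  obtain ⟨F, hFdef⟩ : ∃ F : ℝ → ℝ, ∀ t, F t = f (max t 0) := ⟨_, fun _ => rfl⟩
  have hF : Continuous F := by
    rw [show F = fun t => f (max t 0) from funext hFdef]
    exact hf_cont.comp_continuous (by fun_prop) fun t => Set.mem_Ici.2 (le_max_right _ _)
  have hFf : ∀ t, 0 ≤ t → F t = f t := fun t ht => by rw [hFdef, max_eq_left ht]
  have hpos : ∀ t, 0 < F t := fun t => by rw [hFdef]; exact hf_pos _ (le_max_right _ _)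
  have hone : ∀ t, t ≤ 1 → F t = 1 := fun t ht => by
    rw [hFdef]; exact hf_one _ ⟨le_max_right _ _, max_le ht zero_le_one⟩
  obtain ⟨g, hg⟩ : ∃ g : ℝ → ℝ, ∀ s, g s = (n:ℝ) ^ ((1:ℝ)/n) *
    (∫ t in (0:ℝ)..s, t ^ (n-1) * F t) ^ ((1:ℝ)/n) := ⟨_, fun _ => rfl⟩
  obtain ⟨φ, hφ⟩ : ∃ φ : ℝ → ℝ, ∀ r, φ r = ∫ s in (0:ℝ)..r, g s := ⟨_, fun _ => rfl⟩
  obtain ⟨hgc, hgpos, hgone, hgd, hφd, hφone⟩ := profile_aux n hn F hF hpos hone g φ hg hφ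
  have huφ : ∀ x, u x = φ ‖x‖ := fun x => by
    rw [hu, hφ, ← intervalIntegral.integral_const_mul]
    refine intervalIntegral.integral_congr fun s hs => ?_
    rw [Set.uIcc_of_le (norm_nonneg x)] at hs
    simp only [hg]
    congr 2
    refine intervalIntegral.integral_congr fun t ht => ?_
    rw [Set.uIcc_of_le hs.1] at ht
    simp only [hFf t ht.1]
  have hφc : Continuous φ := continuous_iff_continuousAt.2 fun s => (hφd s).continuousAt
  have hdφ : deriv φ = g := funext fun s => (hφd s).deriv
  have hgmono : MonotoneOn g (Set.Ici 0) := by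
    refine monotoneOn_of_deriv_nonneg (convex_Ici 0) hgc.continuousOn ?_ ?_
    · intro s hs
      rw [interior_Ici] at hs
      exact (hgd s hs).differentiableAt.differentiableWithinAt
    · intro s hs
      rw [interior_Ici] at hs
      rw [(hgd s hs).deriv]
      have h1 := hgpos s hs
      have h2 := hpos s
      have h3 : 0 < s := hs
      positivity
  refine ⟨?_, ?_⟩
  · have himg : ((fun x : EuclideanSpace ℝ (Fin n) => ‖x‖) '' Set.univ) ⊆ Set.Ici 0 := by
      rintro _ ⟨x, -, rfl⟩
      exact norm_nonneg x
    have hconv : ConvexOn ℝ (Set.Ici 0) φ := by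
      refine MonotoneOn.convexOn_of_deriv (convex_Ici 0) hφc.continuousOn
        (fun s _ => (hφd s).differentiableAt.differentiableWithinAt) ?_
      rw [hdφ]
      exact hgmono.mono interior_subset
    have hmono : MonotoneOn φ (Set.Ici 0) := by
      refine monotoneOn_of_deriv_nonneg (convex_Ici 0) hφc.continuousOn
        (fun s _ => (hφd s).differentiableAt.differentiableWithinAt) ?_
      intro s hs
      rw [interior_Ici] at hs
      rw [hdφ]; exact (hgpos s hs).le
    refine ⟨convex_univ, fun x _ y _ α β hα hβ hαβ => ?_⟩
    rw [huφ, huφ, huφ]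
    have hle : ‖α • x + β • y‖ ≤ α * ‖x‖ + β * ‖y‖ := by
      refine (norm_add_le _ _).trans ?_
      rw [norm_smul, norm_smul, Real.norm_of_nonneg hα, Real.norm_of_nonneg hβ]
    exact (hmono (norm_nonneg _) (Set.mem_Ici.2 (by positivity)) hle).trans
      (hconv.2 (norm_nonneg x) (norm_nonneg y) hα hβ hαβ)
  · classical
    obtain ⟨ψ, hψ⟩ : ∃ ψ : ℝ → ℝ, ∀ w, ψ w = if w < 1 then w / 2 else φ (√w) := ⟨_, fun _ => rfl⟩
    obtain ⟨a, ha⟩ : ∃ a : ℝ → ℝ, ∀ w, a w = if w < 1 then 1 else g (√w) / √w := ⟨_, fun _ => rfl⟩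
    obtain ⟨b, hb⟩ : ∃ b : ℝ → ℝ, ∀ w, b w = (F (√w) / a w ^ (n-1) - a w) / (2 * w) :=
      ⟨_, fun _ => rfl⟩
    have hψ1 : ∀ w, w < 1 → ψ w = w / 2 := fun w hw => by rw [hψ, if_pos hw]
    have ha1 : ∀ w, w < 1 → a w = 1 := fun w hw => by rw [ha, if_pos hw]
    have hs1 : ∀ w, w < 1 → √w ≤ 1 := fun w hw => Real.sqrt_le_one.2 hw.le
    have hψ0 : ∀ w, 0 < w → ψ w = φ (√w) := fun w hw => by
      rw [hψ]; split_ifs with h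
      · rw [hφone _ (Real.sqrt_nonneg _) (hs1 w h), Real.sq_sqrt hw.le]
      · rfl
    have ha0 : ∀ w, 0 < w → a w = g (√w) / √w := fun w hw => by
      rw [ha]; split_ifs with h
      · rw [hgone _ (Real.sqrt_nonneg _) (hs1 w h), div_self (Real.sqrt_pos.2 hw).ne']
      · rfl
    have hb1 : ∀ w, w < 1 → b w = 0 := fun w hw => by
      rw [hb, ha1 w hw, hone _ (hs1 w hw)]; simp
    have hapos : ∀ w, 0 < a w := fun w => by
      rcases lt_or_ge w 1 with h | h
      · rw [ha1 w h]; exact one_pos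
      · have hw : 0 < w := by linarith
        rw [ha0 w hw]
        exact div_pos (hgpos _ (Real.sqrt_pos.2 hw)) (Real.sqrt_pos.2 hw)
    have hψd : ∀ w, HasDerivAt ψ (a w / 2) w := fun w => by
      rcases lt_or_ge w 1 with h | h
      · rw [ha1 w h]
        refine ((hasDerivAt_id w).div_const 2).congr_of_eventuallyEq ?_
        filter_upwards [Iio_mem_nhds h] with v hv using hψ1 v hv
      · have hw : 0 < w := by linarith
        have hd := (hφd (√w)).comp w (Real.hasDerivAt_sqrt hw.ne')
        have hd2 := hd.congr_of_eventuallyEq (f₁ := ψ) (by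
          filter_upwards [Ioi_mem_nhds hw] with v hv using hψ0 v hv)
        refine hd2.congr_deriv (Eq.symm ?_)
        rw [ha0 w hw]
        have := Real.sqrt_pos.2 hw
        field_simp
    have had : ∀ w, HasDerivAt a (b w) w := fun w => by
      rcases lt_or_ge w 1 with h | h
      · rw [hb1 w h]
        refine (hasDerivAt_const w (1:ℝ)).congr_of_eventuallyEq ?_
        filter_upwards [Iio_mem_nhds h] with v hv using ha1 v hv
      · have hw : 0 < w := by linarith
        have hr := Real.sqrt_pos.2 hw
        have hd := ((hgd (√w) hr).comp w (Real.hasDerivAt_sqrt hw.ne')).div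
          (Real.hasDerivAt_sqrt hw.ne') hr.ne'
        have hd2 := hd.congr_of_eventuallyEq (f₁ := a) (by
          filter_upwards [Ioi_mem_nhds hw] with v hv using ha0 v hv)
        refine hd2.congr_deriv (Eq.symm ?_)
        rw [hb, ha0 w hw]
        have hg0 := hgpos _ hr
        simp only [Function.comp]
        rw [div_pow]
        have hww : w = √w ^ 2 := (Real.sq_sqrt hw.le).symm
        generalize √w = r at *
        subst hww
        field_simp
    have hac : Continuous a := continuous_iff_continuousAt.2 fun s => (had s).continuousAt
    have hbc : Continuous b := by
      refine continuous_iff_continuousAt.2 fun w => ?_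
      rcases lt_or_ge w 1 with h | h
      · refine (continuousAt_const (y := (0:ℝ))).congr ?_
        filter_upwards [Iio_mem_nhds h] with v hv using (hb1 v hv).symm
      · have hw : 0 < w := by linarith
        rw [show b = fun w => (F (√w) / a w ^ (n-1) - a w) / (2 * w) from funext hb]
        have h1 : ContinuousAt (fun w => F (√w)) w := (hF.comp Real.continuous_sqrt).continuousAt
        have h2 : ContinuousAt a w := hac.continuousAt
        exact ((h1.div (h2.pow _) (pow_pos (hapos w) _).ne').sub h2).div
          (by fun_prop) (by positivity)
    have huψ : ∀ x, u x = ψ (‖x‖ ^ 2) := fun x => by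
      rw [huφ]
      rcases (norm_nonneg x).eq_or_lt with h | h
      · rw [← h, hψ1 _ (by norm_num), hφ]; simp
      · rw [hψ0 _ (by positivity), Real.sqrt_sq h.le]
    obtain ⟨hC, hD⟩ := radial_aux (by omega) ψ a b hψd had hbc (fun w => (hapos w).ne') u huψ
    refine ⟨hC, fun x => ?_⟩
    rw [hD x]
    have hp := hapos (‖x‖ ^ 2)
    have key : a (‖x‖ ^ 2) + 2 * b (‖x‖ ^ 2) * ‖x‖ ^ 2 = F ‖x‖ / a (‖x‖ ^ 2) ^ (n-1) := by
      rcases (norm_nonneg x).eq_or_lt with h | h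
      · rw [← h, ha1 _ (by norm_num), hone 0 (by norm_num)]; simp
      · rw [hb, Real.sqrt_sq h.le]
        field_simp
        ring
    rw [key, ← hFf _ (norm_nonneg x)]
    field_simp
end

section
/- Let n ≥ 3 and let f : [0,∞) → ℝ be continuous with f(t) = 1 for t ∈ [0,1], 1 ≤ f(t) ≤ 2 for t ∈ [1,2], and f(t) = 1 + t^{−2} for t ≥ 2. Define u : ℝⁿ → ℝ by u(x) = n^{1/n} ∫₀^{|x|} ( ∫₀^{s} t^{n−1} f(t) dt )^{1/n} ds. Then there exists a constant C > 0 such that for all x ∈ ℝⁿ with |x| ≥ 2: |u(x) − ½|x|² − (n−2)^{−1} log|x|| ≤ C. In particular, u(x) − ½|x|² is unbounded (of order log|x|) at infinity. -/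
open MeasureTheory intervalIntegral

lemma aux_rpow (p z : ℝ) (hp0 : 0 ≤ p) (hp1 : p ≤ 1) (hz : 0 ≤ z) :
    |(1 + z) ^ p - 1 - p * z| ≤ z ^ 2 := by
  have h1 : (1 + z) ^ p ≤ 1 + p * z :=
    rpow_one_add_le_one_add_mul_self (by linarith) hp0 hp1
  have h2 : 1 + p * (z - z ^ 2) ≤ (1 + z) ^ p := by
    rw [Real.rpow_def_of_pos (by linarith)]
    have h3 := Real.add_one_le_exp (Real.log (1 + z) * p)
    have h4 := Real.one_sub_inv_le_log_of_pos (show 0 < 1 + z by linarith)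
    have h5 : z - z ^ 2 ≤ 1 - (1 + z)⁻¹ := by
      have : 1 - (1 + z)⁻¹ - (z - z ^ 2) = z ^ 3 / (1 + z) := by
        field_simp
        ring
      have h6 : 0 ≤ z ^ 3 / (1 + z) := by positivity
      linarith
    nlinarith
  rw [abs_le]
  constructor <;> nlinarith [sq_nonneg z]

lemma aux_inner (m : ℕ) (s : ℝ) (hs : 2 ≤ s) (f : ℝ → ℝ)
    (hf_tail : ∀ t : ℝ, 2 ≤ t → f t = 1 + t⁻¹ ^ 2) :
    ∫ t in (2:ℝ)..s, t ^ (m+2) * f t =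
      (s ^ (m+3) - 2 ^ (m+3)) / (m+3) + (s ^ (m+1) - 2 ^ (m+1)) / (m+1) := by
  have : ∫ t in (2:ℝ)..s, t ^ (m+2) * f t = ∫ t in (2:ℝ)..s, (t ^ (m+2) + t ^ m) := by
    apply integral_congr
    intro t ht
    rw [Set.uIcc_of_le hs] at ht
    have : 0 < t := by linarith [ht.1]
    simp only
    rw [hf_tail t ht.1]
    field_simp
    ring
  rw [this, intervalIntegral.integral_add (by apply Continuous.intervalIntegrable; fun_prop)
    (by apply Continuous.intervalIntegrable; fun_prop), integral_pow, integral_pow]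
  push_cast
  ring

lemma aux_point (m : ℕ) (c s : ℝ) (hs : 2 ≤ s)
    (hA : s ^ (m+3) ≤ s ^ (m+3) + ((m:ℝ)+3)/(m+1) * s ^ (m+1) + c) :
    |(s ^ (m+3) + ((m:ℝ)+3)/(m+1) * s ^ (m+1) + c) ^ ((1:ℝ)/(m+3:ℕ)) - s - ((m:ℝ)+1)⁻¹ * s⁻¹|
      ≤ (|c| + (((m:ℝ)+3)/(m+1) + |c|)^2) * s⁻¹ ^ 2 := by
  have hs0 : 0 < s := by linarith
  set a : ℝ := ((m:ℝ)+3)/(m+1) with ha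
  have ha0 : 0 ≤ a := by positivity
  set y := s⁻¹ with hy
  have hy0 : 0 < y := by positivity
  have hy1 : y ≤ 1 := inv_le_one_of_one_le₀ (by linarith)
  have hsy : s * y = 1 := mul_inv_cancel₀ hs0.ne'
  have hsyp : ∀ k : ℕ, s ^ k * y ^ k = 1 := fun k => by rw [← mul_pow, hsy, one_pow]
  set z := a * y ^ 2 + c * y ^ (m+3) with hz
  have hAz : s ^ (m+3) + a * s ^ (m+1) + c = s ^ (m+3) * (1 + z) := by
    have e1 : s ^ (m+3) * y ^ 2 = s ^ (m+1) := by
      rw [show m + 3 = (m+1) + 2 by ring, pow_add, mul_assoc, hsyp, mul_one]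
    rw [hz]
    linear_combination (-a) * e1 - c * hsyp (m+3)
  have hz0 : 0 ≤ z := by
    rw [hAz] at hA
    have : 0 < s ^ (m+3) := by positivity
    by_contra h
    push Not at h
    nlinarith
  have hroot : (s ^ (m+3) + a * s ^ (m+1) + c) ^ ((1:ℝ)/(m+3:ℕ)) =
      s * (1 + z) ^ ((1:ℝ)/(m+3:ℕ)) := by
    rw [hAz, Real.mul_rpow (by positivity) (by positivity), one_div,
      Real.pow_rpow_inv_natCast hs0.le (by omega)]
  rw [hroot]
  set p : ℝ := (1:ℝ)/(m+3:ℕ) with hp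
  have hpm : p * ((m:ℝ)+3) = 1 := by rw [hp]; push_cast; field_simp
  have hp0 : 0 ≤ p := by positivity
  have hp1 : p ≤ 1 := by
    have : (0:ℝ) ≤ m := by positivity
    nlinarith
  have hpa : p * a = ((m:ℝ)+1)⁻¹ := by
    rw [ha, ← mul_div_assoc, hpm, one_div]
  have key := aux_rpow p z hp0 hp1 hz0
  have hyp : y ^ (m+2) ≤ y ^ 2 := pow_le_pow_of_le_one hy0.le hy1 (by omega)
  have hyp3 : y ^ (m+3) ≤ y ^ 2 := pow_le_pow_of_le_one hy0.le hy1 (by omega)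
  have hzK : z ≤ (a + |c|) * y ^ 2 := by
    have : c * y ^ (m+3) ≤ |c| * y ^ 2 :=
      (mul_le_mul_of_nonneg_right (le_abs_self c) (by positivity)).trans
        (mul_le_mul_of_nonneg_left hyp3 (abs_nonneg c))
    rw [hz]; linarith
  have hdec : s * (1 + z) ^ p - s - ((m:ℝ)+1)⁻¹ * y
      = s * ((1 + z) ^ p - 1 - p * z) + p * (c * y ^ (m+2)) := by
    rw [← hpa, hz, pow_succ y (m+2)]
    linear_combination (p * a * y + p * c * y ^ (m+2)) * hsy
  rw [hdec]
  have t1 : |s * ((1 + z) ^ p - 1 - p * z)| ≤ (a + |c|)^2 * y ^ 2 := by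
    rw [abs_mul, abs_of_pos hs0]
    have hz2 : z ^ 2 ≤ ((a + |c|) * y ^ 2) ^ 2 := pow_le_pow_left₀ hz0 hzK 2
    calc s * |(1 + z) ^ p - 1 - p * z| ≤ s * ((a + |c|) * y ^ 2) ^ 2 :=
          mul_le_mul_of_nonneg_left (key.trans hz2) hs0.le
      _ = (a + |c|)^2 * y ^ 2 * y := by
          linear_combination ((a + |c|)^2 * y ^ 3) * hsy
      _ ≤ (a + |c|)^2 * y ^ 2 := mul_le_of_le_one_right (by positivity) hy1
  have t2 : |p * (c * y ^ (m+2))| ≤ |c| * y ^ 2 := by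
    rw [abs_mul, abs_of_nonneg hp0, abs_mul, abs_of_pos (show 0 < y ^ (m+2) by positivity)]
    calc p * (|c| * y ^ (m+2)) ≤ |c| * y ^ (m+2) := mul_le_of_le_one_left (by positivity) hp1
      _ ≤ _ := mul_le_mul_of_nonneg_left hyp (abs_nonneg c)
  refine (abs_add_le _ _).trans ?_
  linarith

lemma aux_main (m : ℕ) (f : ℝ → ℝ) (hf : Continuous f)
    (hf1 : ∀ t ∈ Set.Icc (0:ℝ) 2, 1 ≤ f t)
    (hf_tail : ∀ t : ℝ, 2 ≤ t → f t = 1 + t⁻¹ ^ 2) :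
    ∃ C : ℝ, 0 < C ∧ ∀ r : ℝ, 2 ≤ r →
      |((m+3:ℕ):ℝ) ^ ((1:ℝ)/(m+3:ℕ)) *
        (∫ s in (0:ℝ)..r, (∫ t in (0:ℝ)..s, t ^ (m+2) * f t) ^ ((1:ℝ)/(m+3:ℕ)))
        - (1/2 : ℝ) * r ^ 2 - ((m:ℝ) + 1)⁻¹ * Real.log r| ≤ C := by
  have hc : Continuous fun t : ℝ => t ^ (m+2) * f t := by fun_prop
  have hii : ∀ a b : ℝ, IntervalIntegrable (fun t : ℝ => t ^ (m+2) * f t) volume a b :=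
    fun a b => hc.intervalIntegrable a b
  set F : ℝ → ℝ := fun s => ∫ t in (0:ℝ)..s, t ^ (m+2) * f t with hF
  have hFc : Continuous F := continuous_primitive hii 0
  set p : ℝ := (1:ℝ)/(m+3:ℕ) with hp
  have hp0 : 0 ≤ p := by positivity
  set g : ℝ → ℝ := fun s => ((m+3:ℕ):ℝ) ^ p * F s ^ p with hg
  have hgc : Continuous g := continuous_const.mul (hFc.rpow_const fun _ => Or.inr hp0)
  have hF2 : (2:ℝ) ^ (m+3) / (m+3) ≤ F 2 := by
    have e : ∫ t in (0:ℝ)..2, t ^ (m+2) = (2:ℝ) ^ (m+3) / (m+3) := by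
      rw [integral_pow]; push_cast; rw [zero_pow (by omega)]; ring
    rw [← e]
    apply integral_mono_on (by norm_num) (by apply Continuous.intervalIntegrable; fun_prop) (hii _ _)
    intro t ht
    exact le_mul_of_one_le_right (pow_nonneg ht.1 _) (hf1 t ht)
  set c : ℝ := ((m:ℝ)+3) * F 2 - 2 ^ (m+3) - ((m:ℝ)+3)/(m+1) * 2 ^ (m+1) with hcdef
  have hFs : ∀ s, 2 ≤ s → ((m:ℝ)+3) * F s = s ^ (m+3) + ((m:ℝ)+3)/(m+1) * s ^ (m+1) + c := by
    intro s hs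
    have : F s = F 2 + ((s ^ (m+3) - 2 ^ (m+3)) / (m+3) + (s ^ (m+1) - 2 ^ (m+1)) / (m+1)) := by
      rw [← aux_inner m s hs f hf_tail]
      exact (integral_add_adjacent_intervals (hii 0 2) (hii 2 s)).symm
    rw [this, hcdef]
    field_simp
    ring
  have hA : ∀ s, 2 ≤ s → s ^ (m+3) ≤ s ^ (m+3) + ((m:ℝ)+3)/(m+1) * s ^ (m+1) + c := by
    intro s hs
    have h1 : (2:ℝ) ^ (m+1) ≤ s ^ (m+1) := pow_le_pow_left₀ (by norm_num) hs _
    have h2 : ((m:ℝ)+3)/(m+1) * 2 ^ (m+1) ≤ ((m:ℝ)+3)/(m+1) * s ^ (m+1) :=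
      mul_le_mul_of_nonneg_left h1 (by positivity)
    rw [div_le_iff₀ (by positivity)] at hF2
    rw [hcdef]
    linarith
  set K : ℝ := |c| + (((m:ℝ)+3)/(m+1) + |c|)^2 with hK
  have hK0 : 0 ≤ K := by positivity
  have hpt : ∀ s, 2 ≤ s → |g s - s - ((m:ℝ)+1)⁻¹ * s⁻¹| ≤ K * s⁻¹ ^ 2 := by
    intro s hs
    have h0 : 0 ≤ F s := by
      have h1 := hA s hs
      rw [← hFs s hs] at h1
      have h2 : 0 ≤ s ^ (m+3) := by positivity
      have h3 : (0:ℝ) < (m:ℝ) + 3 := by positivity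
      exact nonneg_of_mul_nonneg_right (h2.trans h1) h3
    have : g s = (s ^ (m+3) + ((m:ℝ)+3)/(m+1) * s ^ (m+1) + c) ^ p := by
      rw [← hFs s hs, Real.mul_rpow (by positivity) h0, hg]
      push_cast
      rfl
    rw [this]
    exact aux_point m c s hs (hA s hs)
  set B : ℝ := (∫ s in (0:ℝ)..2, g s) - 2 + -(((m:ℝ)+1)⁻¹ * Real.log 2) with hB
  refine ⟨|B| + K + 1, by positivity, fun r hr => ?_⟩
  have hr0 : 0 < r := by linarith
  have hne : ∀ s ∈ Set.uIcc 2 r, s ≠ 0 := by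
    intro s hs
    rw [Set.uIcc_of_le hr] at hs
    linarith [hs.1]
  have hinv : IntervalIntegrable (fun s : ℝ => s⁻¹) volume 2 r :=
    (ContinuousOn.inv₀ continuousOn_id hne).intervalIntegrable
  have hinv2 : IntervalIntegrable (fun s : ℝ => K * s⁻¹ ^ 2) volume 2 r :=
    (((ContinuousOn.inv₀ continuousOn_id hne).pow 2).const_smul K).intervalIntegrable
  have hI : ∫ s in (2:ℝ)..r, (g s - s - ((m:ℝ)+1)⁻¹ * s⁻¹) =
      (∫ s in (2:ℝ)..r, g s) - (r^2 - 2^2)/2 - ((m:ℝ)+1)⁻¹ * (Real.log r - Real.log 2) := by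
    have hid : IntervalIntegrable (fun s : ℝ => s) volume 2 r := continuous_id.intervalIntegrable _ _
    rw [intervalIntegral.integral_sub ((hgc.intervalIntegrable _ _).sub hid)
      (hinv.const_mul _), intervalIntegral.integral_sub (hgc.intervalIntegrable _ _)
      hid, intervalIntegral.integral_const_mul ((m:ℝ)+1)⁻¹ (fun s => s⁻¹),
      integral_inv_of_pos (by norm_num) hr0, integral_id,
      Real.log_div hr0.ne' (by norm_num)]
  have hbd : |∫ s in (2:ℝ)..r, (g s - s - ((m:ℝ)+1)⁻¹ * s⁻¹)| ≤ K := by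
    have h1 : ‖∫ s in (2:ℝ)..r, (g s - s - ((m:ℝ)+1)⁻¹ * s⁻¹)‖ ≤ ∫ s in (2:ℝ)..r, K * s⁻¹ ^ 2 := by
      apply norm_integral_le_of_norm_le hr _ hinv2
      exact Filter.Eventually.of_forall fun s hs => hpt s hs.1.le
    have h2 : ∫ s in (2:ℝ)..r, K * s⁻¹ ^ 2 = (-(K * r⁻¹)) - (-(K * 2⁻¹)) := by
      apply integral_eq_sub_of_hasDerivAt (f := fun s => -(K * s⁻¹)) _ hinv2
      intro s hs
      have hd := ((hasDerivAt_inv (hne s hs)).const_mul K).neg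
      have he : -(K * -(s ^ 2)⁻¹) = K * s⁻¹ ^ 2 := by rw [inv_pow]; ring
      rw [he] at hd
      exact hd
    rw [Real.norm_eq_abs, h2] at h1
    have : 0 ≤ K * r⁻¹ := by positivity
    linarith
  have hsplit : ((m+3:ℕ):ℝ) ^ p * (∫ s in (0:ℝ)..r, F s ^ p) =
      (∫ s in (0:ℝ)..2, g s) + ∫ s in (2:ℝ)..r, g s := by
    rw [integral_add_adjacent_intervals (hgc.intervalIntegrable _ _) (hgc.intervalIntegrable _ _),
      ← intervalIntegral.integral_const_mul]
  rw [hsplit]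
  have hfin : (∫ s in (0:ℝ)..2, g s) + (∫ s in (2:ℝ)..r, g s) - 1/2 * r ^ 2
      - ((m:ℝ)+1)⁻¹ * Real.log r = B + ∫ s in (2:ℝ)..r, (g s - s - ((m:ℝ)+1)⁻¹ * s⁻¹) := by
    rw [hI, hB]; ring
  rw [hfin]
  refine (abs_add_le _ _).trans ?_
  linarith

/-- Sharpness of `β > 2`: for the radial solution with forcing
`f(t) = 1 + t⁻²` at infinity, the solution deviates from the parabola
`½|x|²` by `(n-2)⁻¹ log|x| + O(1)`. -/
theorem radial_example_log_deviation
    (n : ℕ) (hn : 3 ≤ n) (f : ℝ → ℝ)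
    (hf_cont : ContinuousOn f (Set.Ici (0:ℝ)))
    (hf_one : ∀ t ∈ Set.Icc (0:ℝ) 1, f t = 1)
    (hf_mid : ∀ t ∈ Set.Icc (1:ℝ) 2, 1 ≤ f t ∧ f t ≤ 2)
    (hf_tail : ∀ t : ℝ, 2 ≤ t → f t = 1 + t⁻¹ ^ 2)
    (u : EuclideanSpace ℝ (Fin n) → ℝ)
    (hu : ∀ x, u x = (n:ℝ) ^ ((1:ℝ)/n) *
      ∫ s in (0:ℝ)..‖x‖, (∫ t in (0:ℝ)..s, t ^ (n-1) * f t) ^ ((1:ℝ)/n)) :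
    ∃ C : ℝ, 0 < C ∧ ∀ x : EuclideanSpace ℝ (Fin n), 2 ≤ ‖x‖ →
      |u x - (1/2 : ℝ) * ‖x‖ ^ 2 - ((n:ℝ) - 2)⁻¹ * Real.log ‖x‖| ≤ C := by
  obtain ⟨m, rfl⟩ : ∃ m, n = m + 3 := ⟨n - 3, by omega⟩
  have hcont : Continuous fun t : ℝ => f (max t 0) :=
    hf_cont.comp_continuous (by fun_prop) fun t => le_max_right t 0
  obtain ⟨C, hC, h⟩ := aux_main m (fun t => f (max t 0)) hcont
    (by
      intro t ht
      simp only [max_eq_left ht.1]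
      rcases le_total t 1 with h1 | h1
      · exact (hf_one t ⟨ht.1, h1⟩).ge
      · exact (hf_mid t ⟨h1, ht.2⟩).1)
    (by
      intro t ht
      simp only [max_eq_left (show (0:ℝ) ≤ t by linarith)]
      exact hf_tail t ht)
  refine ⟨C, hC, fun x hx => ?_⟩
  have e : ∫ s in (0:ℝ)..‖x‖, (∫ t in (0:ℝ)..s, t ^ (m+3-1) * f t) ^ ((1:ℝ)/(m+3:ℕ)) =
      ∫ s in (0:ℝ)..‖x‖, (∫ t in (0:ℝ)..s, t ^ (m+2) * f (max t 0)) ^ ((1:ℝ)/(m+3:ℕ)) := by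
    apply integral_congr
    intro s hs
    rw [Set.uIcc_of_le (norm_nonneg x)] at hs
    simp only
    congr 1
    apply integral_congr
    intro t ht
    rw [Set.uIcc_of_le hs.1] at ht
    simp only [max_eq_left ht.1]
    rfl
  have e2 : (((m+3:ℕ):ℝ) - 2) = (m:ℝ) + 1 := by push_cast; ring
  rw [hu, e, e2]
  exact h ‖x‖ hx
end

section
/- Let n ≥ 1 and let M, M₊, M₋ be n×n real symmetric positive definite matrices. Then tr( adj(M) · (M₊ + M₋ − 2M) ) ≥ n · det(M)^{(n−1)/n} · ( det(M₊)^{1/n} + det(M₋)^{1/n} − 2 det(M)^{1/n} ), where adj(M) is the adjugate of M. -/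
theorem adj_tangent_aux
    (n : ℕ) (hn : 1 ≤ n) (M N : Matrix (Fin n) (Fin n) ℝ)
    (hM : M.PosDef) (hN : N.PosDef) :
    (n:ℝ) * M.det ^ (((n:ℝ) - 1)/n) * N.det ^ ((1:ℝ)/n) ≤ (M.adjugate * N).trace := by
  have hn0 : (n:ℝ) ≠ 0 := by positivity
  have hd := hM.det_pos
  have hdN := hN.det_pos
  have hadj : M.adjugate.PosSemidef := by
    have h : M.adjugate = M.det • M⁻¹ := by
      rw [Matrix.inv_def, Ring.inverse_eq_inv', smul_smul, mul_inv_cancel₀ hd.ne', one_smul]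
    rw [h]
    exact hM.inv.posSemidef.smul hd.le
  obtain ⟨B, hB⟩ : ∃ B : Matrix (Fin n) (Fin n) ℝ, M.adjugate = B.conjTranspose * B := by
    open scoped MatrixOrder in
    exact CStarAlgebra.nonneg_iff_eq_star_mul_self.mp hadj.nonneg
  have hP : (B * N * B.conjTranspose).PosSemidef := hN.posSemidef.mul_mul_conjTranspose_same B
  have htr : (M.adjugate * N).trace = (B * N * B.conjTranspose).trace := by
    rw [hB, Matrix.mul_assoc, Matrix.trace_mul_comm]
  have hdet : (B * N * B.conjTranspose).det = M.det ^ (n-1) * N.det := by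
    have h1 := Matrix.det_adjugate M
    rw [hB, Matrix.det_mul, Fintype.card_fin] at h1
    rw [Matrix.det_mul, Matrix.det_mul, ← h1]; ring
  rw [htr]
  have hs := hP.isHermitian.trace_eq_sum_eigenvalues
  have hp := hP.isHermitian.det_eq_prod_eigenvalues
  have hnn := hP.eigenvalues_nonneg
  rw [hdet] at hp
  simp only [RCLike.ofReal_real_eq_id, id] at hs hp
  have amgm := Real.geom_mean_le_arith_mean Finset.univ (fun _ => (1:ℝ))
    hP.isHermitian.eigenvalues (by simp) (by simp; omega) (fun i _ => hnn i)
  simp only [Real.rpow_one, one_mul, Finset.sum_const, Finset.card_univ, Fintype.card_fin,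
    nsmul_eq_mul, mul_one] at amgm
  rw [← hs, ← hp, le_div_iff₀ (by positivity), Real.mul_rpow (by positivity) hdN.le,
    ← Real.rpow_natCast, ← Real.rpow_mul hd.le, Nat.cast_sub hn, Nat.cast_one,
    ← div_eq_mul_inv, ← one_div] at amgm
  linarith

/-- Combination of midpoint concavity and the tangent-plane inequality for
`det^{1/n}`: the trace of `adj(M)` against a second difference of positive
definite matrices dominates the second difference of `det^{1/n}`. -/
theorem adjugate_trace_second_difference_inequality
    (n : ℕ) (hn : 1 ≤ n) (M Mp Mm : Matrix (Fin n) (Fin n) ℝ)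
    (hM : M.PosDef) (hMp : Mp.PosDef) (hMm : Mm.PosDef) :
    (M.adjugate * (Mp + Mm - (2:ℝ) • M)).trace ≥
      (n:ℝ) * M.det ^ (((n:ℝ) - 1)/n) *
        (Mp.det ^ ((1:ℝ)/n) + Mm.det ^ ((1:ℝ)/n) - 2 * M.det ^ ((1:ℝ)/n)) := by
  have h1 := adj_tangent_aux n hn M Mp hM hMp
  have h2 := adj_tangent_aux n hn M Mm hM hMm
  have hn0 : (n:ℝ) ≠ 0 := by positivity
  have h3 : M.det ^ (((n:ℝ) - 1)/n) * M.det ^ ((1:ℝ)/n) = M.det := by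
    rw [← Real.rpow_add hM.det_pos, ← add_div, sub_add_cancel, div_self hn0, Real.rpow_one]
  have h4 : (M.adjugate * (Mp + Mm - (2:ℝ) • M)).trace =
      (M.adjugate * Mp).trace + (M.adjugate * Mm).trace - 2 * (n * M.det) := by
    rw [Matrix.mul_sub, Matrix.mul_add, Matrix.mul_smul, Matrix.adjugate_mul]
    simp [Matrix.trace_sub, Matrix.trace_add, Matrix.trace_smul]
    ring
  rw [h4]
  linear_combination h1 + h2 - 2 * n * h3
end

section
/- Let n ≥ 3 and β > 2 with β ≠ n−2. Then there exists a constant C > 0, depending only on n and β, such that for all x ∈ ℝⁿ: ∫_{ℝⁿ} |x−y|^{2−n} (1+|y|)^{−2−β} dy ≤ C (1+|x|)^{−β₁}, where β₁ = min{n−2, β}. -/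
open MeasureTheory

lemma rpd_integrable (n : ℕ) (hn : 3 ≤ n) (p q : ℝ) (hq : 0 ≤ q) (hp : p < n)
    (hpq : (n:ℝ) < p + q) :
    Integrable (fun y : EuclideanSpace ℝ (Fin n) => ‖y‖ ^ (-p) * (1 + ‖y‖) ^ (-q)) := by
  haveI : Nonempty (Fin n) := ⟨⟨0, by omega⟩⟩
  rw [integrable_fun_norm_addHaar (f := fun r : ℝ => r ^ (-p) * (1 + r) ^ (-q)) volume]
  have hm : ∀ s : Set ℝ, AEStronglyMeasurable
      (fun y : ℝ => y ^ (Module.finrank ℝ (EuclideanSpace ℝ (Fin n)) - 1) •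
        (y ^ (-p) * (1 + y) ^ (-q))) (volume.restrict s) := by
    intro s
    apply Measurable.aestronglyMeasurable
    simp only [smul_eq_mul]
    fun_prop
  have hpow : ∀ y : ℝ, 0 < y →
      y ^ (Module.finrank ℝ (EuclideanSpace ℝ (Fin n)) - 1) = y ^ ((n:ℝ) - 1) := by
    intro y hy
    rw [finrank_euclideanSpace_fin, ← Real.rpow_natCast, Nat.cast_sub (by omega)]
    simp
  rw [← Set.Ioc_union_Ioi_eq_Ioi (zero_le_one : (0:ℝ) ≤ 1)]
  apply IntegrableOn.union
  · have h1 : IntegrableOn (fun y : ℝ => y ^ ((n:ℝ) - 1 - p)) (Set.Ioc 0 1) := by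
      rw [← intervalIntegrable_iff_integrableOn_Ioc_of_le zero_le_one]
      exact intervalIntegral.intervalIntegrable_rpow' (by linarith)
    refine Integrable.mono' h1 (hm _) ?_
    filter_upwards [ae_restrict_mem measurableSet_Ioc] with y hy
    have hy0 : 0 < y := hy.1
    rw [hpow y hy0, smul_eq_mul, Real.norm_of_nonneg (by positivity), ← mul_assoc,
      ← Real.rpow_add hy0, ← sub_eq_add_neg]
    apply mul_le_of_le_one_right (by positivity)
    exact Real.rpow_le_one_of_one_le_of_nonpos (by linarith) (by linarith)
  · have h1 : IntegrableOn (fun y : ℝ => y ^ ((n:ℝ) - 1 - p - q)) (Set.Ioi 1) :=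
      integrableOn_Ioi_rpow_of_lt (by linarith) one_pos
    refine Integrable.mono' h1 (hm _) ?_
    filter_upwards [ae_restrict_mem measurableSet_Ioi] with y hy
    have hy0 : 0 < y := lt_trans one_pos hy
    rw [hpow y hy0, smul_eq_mul, Real.norm_of_nonneg (by positivity), ← mul_assoc,
      ← Real.rpow_add hy0, ← sub_eq_add_neg, sub_eq_add_neg ((n:ℝ) - 1 - p) q,
      Real.rpow_add hy0]
    apply mul_le_mul_of_nonneg_left _ (by positivity)
    exact Real.rpow_le_rpow_of_nonpos hy0 (by linarith) (by linarith)

lemma rpd_scaled (n : ℕ) (hn : 3 ≤ n) (p q : ℝ) (hq : 0 ≤ q) (hp : p < n)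
    (hpq : (n:ℝ) < p + q) : ∃ K : ℝ, 0 ≤ K ∧ ∀ R : ℝ, 0 < R →
    Integrable (fun y : EuclideanSpace ℝ (Fin n) => ‖y‖ ^ (-p) * (R + ‖y‖) ^ (-q)) ∧
    ∫ y : EuclideanSpace ℝ (Fin n), ‖y‖ ^ (-p) * (R + ‖y‖) ^ (-q) = K * R ^ ((n:ℝ) - p - q) := by
  have hI := rpd_integrable n hn p q hq hp hpq
  refine ⟨∫ y : EuclideanSpace ℝ (Fin n), ‖y‖ ^ (-p) * (1 + ‖y‖) ^ (-q),
    integral_nonneg fun y => by positivity, fun R hR => ?_⟩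
  have heq : (fun y : EuclideanSpace ℝ (Fin n) => ‖y‖ ^ (-p) * (R + ‖y‖) ^ (-q)) =
      fun y => R ^ (-p - q) * (fun z : EuclideanSpace ℝ (Fin n) =>
        ‖z‖ ^ (-p) * (1 + ‖z‖) ^ (-q)) (R⁻¹ • y) := by
    funext y
    have e1 : ‖y‖ = R * ‖R⁻¹ • y‖ := by
      rw [norm_smul, norm_inv, Real.norm_of_nonneg hR.le]; field_simp
    have e2 : R + ‖y‖ = R * (1 + ‖R⁻¹ • y‖) := by rw [e1]; ring_nf
    rw [e2, e1, Real.mul_rpow hR.le (norm_nonneg _), Real.mul_rpow hR.le (by positivity),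
      sub_eq_add_neg, Real.rpow_add hR]
    have e3 : R * ‖R⁻¹ • y‖ = ‖y‖ := e1.symm
    ring
  rw [heq]
  refine ⟨(hI.comp_smul (inv_ne_zero hR.ne')).const_mul _, ?_⟩
  rw [integral_const_mul, Measure.integral_comp_inv_smul_of_nonneg volume
      (fun z : EuclideanSpace ℝ (Fin n) => ‖z‖ ^ (-p) * (1 + ‖z‖) ^ (-q)) hR.le,
    finrank_euclideanSpace_fin, smul_eq_mul, ← Real.rpow_natCast, ← mul_assoc,
    ← Real.rpow_add hR, mul_comm]
  congr 2
  ring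

/-- far part -/
lemma rpd_far (n : ℕ) (hn : 3 ≤ n) (β : ℝ) (hβ : 2 < β) (hβn : β ≠ (n:ℝ) - 2) :
    ∃ C : ℝ, 0 ≤ C ∧ ∀ x : EuclideanSpace ℝ (Fin n),
      ∃ g : EuclideanSpace ℝ (Fin n) → ℝ, Integrable g ∧ (∀ y, 0 ≤ g y) ∧
      (∫ y, g y) ≤ C * (1 + ‖x‖) ^ (-(min ((n:ℝ) - 2) β)) ∧
      ∀ y, y ≠ 0 → (1 + ‖x‖) / 2 ≤ ‖x - y‖ →
        ‖x - y‖ ^ ((2:ℝ) - n) * (1 + ‖y‖) ^ (-(2:ℝ) - β) ≤ g y := by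
  have hn' : (3:ℝ) ≤ n := by exact_mod_cast hn
  rcases lt_or_gt_of_ne hβn with h | h
  · rw [min_eq_right h.le]
    obtain ⟨K, hK, hs⟩ := rpd_scaled n hn (2 + β) ((n:ℝ) - 2) (by linarith) (by linarith)
      (by linarith)
    refine ⟨5 ^ ((n:ℝ) - 2) * K, by positivity, fun x => ?_⟩
    have hR : 0 < 1 + ‖x‖ := by positivity
    obtain ⟨h1, h2⟩ := hs _ hR
    refine ⟨_, h1.const_mul (5 ^ ((n:ℝ) - 2)), fun y => by positivity, ?_, ?_⟩
    · rw [integral_const_mul, h2, mul_assoc]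
      apply le_of_eq
      congr 3
      ring
    · intro y hy hxy
      have hy0 : 0 < ‖y‖ := norm_pos_iff.mpr hy
      have ht : ‖y‖ ≤ ‖x‖ + ‖x - y‖ := by
        have := norm_sub_norm_le y x
        rw [norm_sub_rev] at this; linarith
      have a1 : ‖x - y‖ ^ ((2:ℝ) - n) ≤ 5 ^ ((n:ℝ) - 2) * (1 + ‖x‖ + ‖y‖) ^ (-((n:ℝ) - 2)) := by
        have : (1 + ‖x‖ + ‖y‖) / 5 ≤ ‖x - y‖ := by linarith
        refine (Real.rpow_le_rpow_of_nonpos (by positivity) this (by linarith)).trans ?_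
        rw [Real.div_rpow (by positivity) (by positivity), div_eq_mul_inv,
          ← Real.rpow_neg (by positivity), mul_comm]
        apply le_of_eq
        congr 2 <;> ring
      have a2 : (1 + ‖y‖) ^ (-(2:ℝ) - β) ≤ ‖y‖ ^ (-(2 + β)) := by
        rw [show -(2 + β) = -(2:ℝ) - β by ring]
        exact Real.rpow_le_rpow_of_nonpos hy0 (by linarith) (by linarith)
      calc _ ≤ (5 ^ ((n:ℝ) - 2) * (1 + ‖x‖ + ‖y‖) ^ (-((n:ℝ) - 2))) * ‖y‖ ^ (-(2 + β)) := by
            gcongr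
        _ = _ := by ring
  · rw [min_eq_left h.le]
    have hI := rpd_integrable n hn 0 (2 + β) (by linarith) (by linarith) (by linarith)
    set K := ∫ y : EuclideanSpace ℝ (Fin n), ‖y‖ ^ (-(0:ℝ)) * (1 + ‖y‖) ^ (-(2 + β)) with hKd
    have hK : 0 ≤ K := integral_nonneg fun y => by positivity
    refine ⟨2 ^ ((n:ℝ) - 2) * K, by positivity, fun x => ?_⟩
    have hR : 0 < 1 + ‖x‖ := by positivity
    refine ⟨_, hI.const_mul (((1 + ‖x‖) / 2) ^ ((2:ℝ) - n)), fun y => by positivity, ?_, ?_⟩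
    · rw [integral_const_mul, ← hKd, Real.div_rpow (by positivity) (by positivity),
        div_eq_mul_inv, ← Real.rpow_neg (by positivity), neg_sub, neg_sub]
      apply le_of_eq; ring
    · intro y hy hxy
      rw [neg_zero, Real.rpow_zero, one_mul, show -(2 + β) = -(2:ℝ) - β by ring]
      gcongr ?_ * _
      exact Real.rpow_le_rpow_of_nonpos (by positivity) hxy (by linarith)

/-- near part -/
lemma rpd_near (n : ℕ) (hn : 3 ≤ n) (β : ℝ) (hβ : 2 < β) :
    ∃ C : ℝ, 0 ≤ C ∧ ∀ x : EuclideanSpace ℝ (Fin n),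
      ∃ g : EuclideanSpace ℝ (Fin n) → ℝ, Integrable g ∧ (∀ y, 0 ≤ g y) ∧
      (∫ y, g y) ≤ C * (1 + ‖x‖) ^ (-(min ((n:ℝ) - 2) β)) ∧
      ∀ y, ‖x - y‖ ≤ (1 + ‖x‖) / 2 →
        ‖x - y‖ ^ ((2:ℝ) - n) * (1 + ‖y‖) ^ (-(2:ℝ) - β) ≤ g y := by
  have hn' : (3:ℝ) ≤ n := by exact_mod_cast hn
  obtain ⟨K, hK, hs⟩ := rpd_scaled n hn ((n:ℝ) - 2) 3 (by linarith) (by linarith) (by linarith)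
  refine ⟨2 ^ (2 + β) * (3 / 2 : ℝ) ^ (3:ℝ) * K, by positivity, fun x => ?_⟩
  have hR : 0 < 1 + ‖x‖ := by positivity
  obtain ⟨h1, h2⟩ := hs _ hR
  refine ⟨_, (h1.comp_sub_left x).const_mul
    (((1 + ‖x‖) / 2) ^ (-(2:ℝ) - β) * (3 / 2 * (1 + ‖x‖)) ^ (3:ℝ)), fun y => by positivity, ?_, ?_⟩
  · rw [integral_const_mul, integral_sub_left_eq_self (fun y : EuclideanSpace ℝ (Fin n) =>
      ‖y‖ ^ (-((n:ℝ) - 2)) * (1 + ‖x‖ + ‖y‖) ^ (-(3:ℝ))) volume x, h2,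
      Real.div_rpow (by positivity) (by positivity),
      Real.mul_rpow (by positivity) (by positivity),
      div_eq_mul_inv, ← Real.rpow_neg (by positivity : (0:ℝ) ≤ 2)]
    have e : (1 + ‖x‖) ^ (-β) = (1 + ‖x‖) ^ (-(2:ℝ) - β) * (1 + ‖x‖) ^ (3:ℝ) *
        (1 + ‖x‖) ^ ((n:ℝ) - (n - 2) - 3) := by
      rw [← Real.rpow_add hR, ← Real.rpow_add hR]; congr 1; ring
    calc _ = 2 ^ (2 + β) * (3 / 2 : ℝ) ^ (3:ℝ) * K * (1 + ‖x‖) ^ (-β) := by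
          rw [e, show -(-(2:ℝ) - β) = 2 + β by ring]; ring
      _ ≤ _ := by
          gcongr
          · linarith [norm_nonneg x]
          · exact min_le_right _ _
  · intro y hxy
    have ht : ‖x‖ ≤ ‖y‖ + ‖x - y‖ := by
      have := norm_sub_norm_le x y
      linarith
    have a1 : (1 + ‖y‖) ^ (-(2:ℝ) - β) ≤ ((1 + ‖x‖) / 2) ^ (-(2:ℝ) - β) :=
      Real.rpow_le_rpow_of_nonpos (by positivity) (by linarith) (by linarith)
    have a2 : 1 ≤ (3 / 2 * (1 + ‖x‖)) ^ (3:ℝ) * (1 + ‖x‖ + ‖x - y‖) ^ (-(3:ℝ)) := by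
      rw [Real.rpow_neg (by positivity), ← div_eq_mul_inv, one_le_div (by positivity)]
      exact Real.rpow_le_rpow (by positivity) (by linarith) (by norm_num)
    calc _ ≤ ‖x - y‖ ^ ((2:ℝ) - n) * ((1 + ‖x‖) / 2) ^ (-(2:ℝ) - β) * 1 := by
          rw [mul_one]; gcongr
      _ ≤ ‖x - y‖ ^ ((2:ℝ) - n) * ((1 + ‖x‖) / 2) ^ (-(2:ℝ) - β) *
          ((3 / 2 * (1 + ‖x‖)) ^ (3:ℝ) * (1 + ‖x‖ + ‖x - y‖) ^ (-(3:ℝ))) := by gcongr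
      _ = _ := by rw [neg_sub]; ring

/-- Riesz-potential estimate (the core of (p3h1)): convolving the decaying source
`(1+|y|)^{-2-β}` with the Newtonian-type kernel `|x-y|^{2-n}` produces decay at the
rate `β₁ = min{n-2, β}`. -/
theorem riesz_potential_decay
    (n : ℕ) (hn : 3 ≤ n) (β : ℝ) (hβ : 2 < β) (hβn : β ≠ (n:ℝ) - 2) :
    ∃ C : ℝ, 0 < C ∧
      ∀ x : EuclideanSpace ℝ (Fin n),
        (∫ y : EuclideanSpace ℝ (Fin n),
            ‖x - y‖ ^ ((2:ℝ) - n) * (1 + ‖y‖) ^ (-(2:ℝ) - β))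
          ≤ C * (1 + ‖x‖) ^ (-(min ((n:ℝ) - 2) β)) := by
  obtain ⟨C1, hC1, H1⟩ := rpd_far n hn β hβ hβn
  obtain ⟨C2, hC2, H2⟩ := rpd_near n hn β hβ
  refine ⟨C1 + C2 + 1, by positivity, fun x => ?_⟩
  obtain ⟨g1, i1, p1, b1, m1⟩ := H1 x
  obtain ⟨g2, i2, p2, b2, m2⟩ := H2 x
  haveI : Nonempty (Fin n) := ⟨⟨0, by omega⟩⟩
  have hne : ∀ᵐ y : EuclideanSpace ℝ (Fin n), y ≠ 0 := by
    rw [ae_iff]; simp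
  have hle : (∫ y : EuclideanSpace ℝ (Fin n),
      ‖x - y‖ ^ ((2:ℝ) - n) * (1 + ‖y‖) ^ (-(2:ℝ) - β)) ≤ ∫ y, (g1 y + g2 y) := by
    apply integral_mono_of_nonneg
    · exact Filter.Eventually.of_forall fun y => by positivity
    · exact i1.add i2
    · filter_upwards [hne] with y hy
      rcases le_total ((1 + ‖x‖) / 2) ‖x - y‖ with h | h
      · linarith [m1 y hy h, p2 y]
      · linarith [m2 y h, p1 y]
  rw [integral_add i1 i2] at hle
  have : 0 ≤ (1 + ‖x‖) ^ (-(min ((n:ℝ) - 2) β)) := by positivity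
  linarith
end

section
/- Let n ≥ 2, δ > 0, r > 0, λ > 0 and β̄ ≥ 0. Let B'_δ = {(0,x₂,…,xₙ) ∈ ℝⁿ : |(0,x₂,…,xₙ)| < δ} and let K be the convex hull of the closure of B'_δ together with the point r e₁, where e₁ = (1,0,…,0). Suppose u : K → ℝ is continuous, convex and nonnegative, u is twice continuously differentiable on the interior of K with det(D²u(x)) ≥ λ for all x in the interior of K, and u ≤ β̄ on the closure of B'_δ. Then there exists a constant C > 1 depending only on n such that max{β̄, u(r e₁)} ≥ C^{−1} λ^{1/n} δ^{2(n−1)/n} r^{2/n}. -/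
open Filter Topology

lemma aux_line {E : Type*} [NormedAddCommGroup E] [NormedSpace ℝ E] {u : E → ℝ} {x : E}
    (hu : ContDiffAt ℝ 2 u x) (v : E) :
    (∀ᶠ t in 𝓝 (0:ℝ), HasDerivAt (fun t : ℝ => u (x + t • v)) (fderiv ℝ u (x + t • v) v) t) ∧
    HasDerivAt (fun t : ℝ => fderiv ℝ u (x + t • v) v) (fderiv ℝ (fderiv ℝ u) x v v) 0 := by
  have hl : ∀ t : ℝ, HasDerivAt (fun t : ℝ => x + t • v) v t := fun t => by
    simpa using ((hasDerivAt_id t).smul_const v).const_add x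
  have hc : Tendsto (fun t : ℝ => x + t • v) (𝓝 0) (𝓝 x) := by
    simpa using (hl 0).continuousAt.tendsto
  constructor
  · have h1 : ∀ᶠ y in 𝓝 x, DifferentiableAt ℝ u y := by
      have := hu.eventually (by simp)
      filter_upwards [this] with y hy using hy.differentiableAt (by norm_num)
    filter_upwards [hc.eventually h1] with t ht
    exact ht.hasFDerivAt.comp_hasDerivAt t (hl t)
  · have h2 : DifferentiableAt ℝ (fderiv ℝ u) x :=
      (hu.fderiv_right (m := 1) (by norm_num)).differentiableAt (by norm_num)
    have h3 : HasFDerivAt (fderiv ℝ u) (fderiv ℝ (fderiv ℝ u) x) (x + (0:ℝ) • v) := by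
      simpa using h2.hasFDerivAt
    have h4 := h3.comp_hasDerivAt (0:ℝ) (hl 0)
    exact (ContinuousLinearMap.apply ℝ ℝ v).hasFDerivAt.comp_hasDerivAt (0:ℝ) h4

lemma aux_second {φ φ' : ℝ → ℝ} {m : ℝ} (h1 : ∀ᶠ t in 𝓝 (0:ℝ), HasDerivAt φ (φ' t) t)
    (h2 : HasDerivAt φ' m 0) (hmin : IsLocalMin φ 0) : 0 ≤ m := by
  by_contra hm
  push Not at hm
  have e1 : deriv φ =ᶠ[𝓝 0] φ' := by
    filter_upwards [h1] with t ht using ht.deriv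
  have e2 : deriv (deriv φ) 0 = m := by rw [e1.deriv_eq, h2.deriv]
  have hmax : IsLocalMax φ 0 :=
    isLocalMax_of_deriv_deriv_neg (by rw [e2]; exact hm) hmin.deriv_eq_zero
      h1.self_of_nhds.continuousAt
  have e3 : φ =ᶠ[𝓝 0] fun _ => φ 0 := by
    filter_upwards [hmin, hmax] with t a b using le_antisymm b a
  have e4 : deriv φ =ᶠ[𝓝 0] fun _ => (0:ℝ) := by
    simpa using e3.deriv
  have e5 := e4.deriv_eq
  simp [e2] at e5
  linarith

lemma aux_convex {E : Type*} [NormedAddCommGroup E] [NormedSpace ℝ E] {u : E → ℝ} {x : E}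
    {K : Set E} (hK : ConvexOn ℝ K u) (hx : K ∈ 𝓝 x)
    (hu : ContDiffAt ℝ 2 u x) (v : E) : 0 ≤ fderiv ℝ (fderiv ℝ u) x v v := by
  obtain ⟨h1, h2⟩ := aux_line hu v
  set d := fderiv ℝ u (x + (0:ℝ) • v) v with hd
  have hg0 : HasDerivAt (fun t : ℝ => u (x + t • v)) d 0 := h1.self_of_nhds
  have hS : ConvexOn ℝ ((fun t : ℝ => x + t • v) ⁻¹' K) (fun t : ℝ => u (x + t • v)) := by
    have := hK.comp_affineMap (AffineMap.lineMap x (x + v) : ℝ →ᵃ[ℝ] E)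
    have e : (fun t : ℝ => x + t • v) = (AffineMap.lineMap x (x + v) : ℝ →ᵃ[ℝ] E) := by
      ext t; simp [AffineMap.lineMap_apply, add_comm]
    have e' : (fun t : ℝ => u (x + t • v)) = u ∘ (AffineMap.lineMap x (x + v) : ℝ →ᵃ[ℝ] E) := by
      rw [← e]; rfl
    rw [e', e]
    exact this
  have hSn : (fun t : ℝ => x + t • v) ⁻¹' K ∈ 𝓝 (0:ℝ) := by
    have hc : ContinuousAt (fun t : ℝ => x + t • v) 0 := by fun_prop
    exact hc.preimage_mem_nhds (by simpa using hx)
  have h0 := mem_of_mem_nhds hSn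
  refine aux_second (φ := fun t => u (x + t • v) - t * d)
    (φ' := fun t => fderiv ℝ u (x + t • v) v - d) ?_ (h2.sub_const d) ?_
  · filter_upwards [h1] with t ht
    have h5 : HasDerivAt (fun t : ℝ => t * d) d t := by
      simpa using (hasDerivAt_id t).mul_const d
    exact ht.sub h5
  · filter_upwards [hSn] with t ht
    simp only [zero_mul, sub_zero]
    rcases lt_trichotomy t 0 with h | h | h
    · have := hS.slope_le_of_hasDerivAt ht h0 h hg0
      rw [slope_def_field, div_le_iff₀ (by linarith)] at this
      linarith
    · subst h; simp
    · have := hS.le_slope_of_hasDerivAt h0 ht h hg0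
      rw [slope_def_field, le_div_iff₀ (by linarith)] at this
      linarith

lemma aux_amgm {n : ℕ} (hn : 0 < n) (z : Fin n → ℝ) (hz : ∀ i, 0 ≤ z i) (k : ℝ)
    (hk : ∑ i, z i ≤ n * k) : ∏ i, z i ≤ k ^ n := by
  have hn' : (0:ℝ) < n := by exact_mod_cast hn
  have h := Real.geom_mean_le_arith_mean_weighted Finset.univ (fun _ => (1:ℝ)/n) z
    (fun _ _ => by positivity) (by simp; field_simp) (fun i _ => hz i)
  rw [← Finset.mul_sum, Real.finsetProd_rpow _ _ (fun i _ => hz i)] at h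
  have h2 : (∏ i, z i) ^ ((1:ℝ)/n) ≤ k := by
    refine h.trans ?_
    rw [one_div, inv_mul_le_iff₀ hn']; exact hk
  have hp : 0 ≤ ∏ i, z i := Finset.prod_nonneg fun i _ => hz i
  calc ∏ i, z i = ((∏ i, z i) ^ ((1:ℝ)/n)) ^ n := by
        rw [one_div, Real.rpow_inv_natCast_pow hp hn.ne']
    _ ≤ k ^ n := pow_le_pow_left₀ (by positivity) h2 n

lemma aux_det {n : ℕ} (hn : 0 < n) (A : Matrix (Fin n) (Fin n) ℝ) (hA : A.PosSemidef) (k : ℝ)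
    (hk : ∀ i, A i i ≤ k) : A.det ≤ k ^ n := by
  rw [hA.1.det_eq_prod_eigenvalues]
  refine aux_amgm hn _ (fun i => hA.eigenvalues_nonneg i) k ?_
  have := hA.1.trace_eq_sum_eigenvalues
  simp only [RCLike.ofReal_real_eq_id, id] at this ⊢
  rw [← this, Matrix.trace]
  calc _ ≤ ∑ i : Fin n, k := Finset.sum_le_sum fun i _ => hk i
    _ = _ := by simp

lemma aux_hess {n : ℕ} (hn : 0 < n) (u : EuclideanSpace ℝ (Fin n) → ℝ)
    (x : EuclideanSpace ℝ (Fin n)) (hu : ContDiffAt ℝ 2 u x)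
    (hpos : ∀ v, 0 ≤ fderiv ℝ (fderiv ℝ u) x v v) (a : Fin n → ℝ) (k : ℝ)
    (hk : ∀ i, fderiv ℝ (fderiv ℝ u) x (a i • EuclideanSpace.single i 1)
      (a i • EuclideanSpace.single i 1) ≤ k) :
    (∏ i, a i) ^ 2 * (hess u x).det ≤ k ^ n := by
  have hsym := hu.isSymmSndFDerivAt (by simp)
  have hent : ∀ i j, hess u x i j = fderiv ℝ (fderiv ℝ u) x (EuclideanSpace.single i 1)
      (EuclideanSpace.single j 1) := fun i j => by
    simp [hess, iteratedFDeriv_two_apply]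
  have hP : (hess u x).PosSemidef := by
    refine Matrix.PosSemidef.of_dotProduct_mulVec_nonneg ?_ ?_
    · ext i j
      simp only [Matrix.conjTranspose_apply, star_trivial, hent]
      exact hsym _ _
    · intro y
      have := hpos (∑ i, y i • EuclideanSpace.single i 1)
      refine this.trans_eq ?_
      simp only [dotProduct, Matrix.mulVec, hent, Finset.mul_sum, map_sum, map_smul,
        ContinuousLinearMap.sum_apply, ContinuousLinearMap.smul_apply, smul_eq_mul,
        Pi.star_apply, star_trivial]
      rw [Finset.sum_comm]
      refine Finset.sum_congr rfl fun i _ => Finset.sum_congr rfl fun j _ => ?_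
      ring_nf
  have hP2 := hP.conjTranspose_mul_mul_same (Matrix.diagonal a)
  have := aux_det hn _ hP2 k (fun i => by
    refine le_trans (le_of_eq ?_) (hk i)
    simp [Matrix.diagonal_conjTranspose, Matrix.mul_diagonal, Matrix.diagonal_mul, hent]
    try ring)
  simp [Matrix.diagonal_conjTranspose] at this
  linarith

lemma aux_core {n : ℕ} (hn : 0 < n) (K : Set (EuclideanSpace ℝ (Fin n)))
    (u : EuclideanSpace ℝ (Fin n) → ℝ) (hK : ConvexOn ℝ K u)
    (c : EuclideanSpace ℝ (Fin n)) (a : Fin n → ℝ) (M k lam : ℝ)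
    (hT : ∀ w : EuclideanSpace ℝ (Fin n), ‖w‖ ≤ 1 →
      c + WithLp.toLp 2 (fun i => a i * w i) ∈ interior K)
    (hC : ContDiffOn ℝ 2 u (interior K))
    (hdet : ∀ x ∈ interior K, lam ≤ (hess u x).det)
    (h0 : ∀ x ∈ K, 0 ≤ u x) (hM : ∀ x ∈ K, u x ≤ M) (hk : 2 * M < k) :
    (∏ i, a i) ^ 2 * lam ≤ k ^ n := by
  set T : EuclideanSpace ℝ (Fin n) → EuclideanSpace ℝ (Fin n) :=
    fun w => c + WithLp.toLp 2 (fun i => a i * w i) with hTdef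
  have hTc : Continuous T := by
    simp only [hTdef]; fun_prop
  have hline : ∀ w i (t : ℝ), T (w + t • EuclideanSpace.single i 1) =
      T w + t • (a i • EuclideanSpace.single i (1:ℝ)) := by
    intro w i t
    ext j
    by_cases h : j = i
    · subst h; simp [hTdef]; ring
    · simp [hTdef, h]
  set Q : EuclideanSpace ℝ (Fin n) → ℝ := fun w => u (T w) - k / 2 * ‖w‖ ^ 2 with hQ
  have hQc : ContinuousOn Q (Metric.closedBall 0 1) := by
    refine ContinuousOn.sub ?_ (by fun_prop)
    refine hC.continuousOn.comp hTc.continuousOn ?_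
    intro w hw
    exact hT w (by simpa using hw)
  obtain ⟨w, hw, hmax⟩ := (isCompact_closedBall (0 : EuclideanSpace ℝ (Fin n)) 1).exists_isMaxOn
    ⟨0, by simp⟩ hQc
  have hw1 : ‖w‖ ≤ 1 := by simpa using hw
  have hwlt : ‖w‖ < 1 := by
    refine lt_of_le_of_ne hw1 fun h => ?_
    have h1 : Q 0 ≤ Q w := hmax (by simp)
    have h2 : 0 ≤ u (T 0) := h0 _ (interior_subset (hT 0 (by simp)))
    have h3 : u (T w) ≤ M := hM _ (interior_subset (hT w hw1))
    simp only [hQ, h, norm_zero] at h1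
    nlinarith
  have hx := hT w hw1
  have hKn : interior K ∈ 𝓝 (T w) := isOpen_interior.mem_nhds hx
  have hu : ContDiffAt ℝ 2 u (T w) := hC.contDiffAt hKn
  have hpos := fun v => aux_convex hK (mem_of_superset hKn interior_subset) hu v
  refine le_trans (mul_le_mul_of_nonneg_left (hdet _ hx) (sq_nonneg _))
    (aux_hess hn u (T w) hu hpos a k fun i => ?_)
  obtain ⟨h1, h2⟩ := aux_line hu (a i • EuclideanSpace.single i (1:ℝ))
  set v : EuclideanSpace ℝ (Fin n) := a i • EuclideanSpace.single i (1:ℝ) with hv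
  have hnorm : ∀ t : ℝ, ‖w + t • EuclideanSpace.single i (1:ℝ)‖ ^ 2
      = ‖w‖ ^ 2 + 2 * t * w i + t ^ 2 := by
    intro t
    rw [norm_add_sq_real, norm_smul, inner_smul_right]
    simp [EuclideanSpace.inner_single_right]
    ring
  have key : 0 ≤ k - fderiv ℝ (fderiv ℝ u) (T w) v v := by
    refine aux_second (φ := fun t => k / 2 * (‖w‖ ^ 2 + 2 * t * w i + t ^ 2) - u (T w + t • v))
      (φ' := fun t => k * (w i + t) - fderiv ℝ u (T w + t • v) v) ?_ ?_ ?_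
    · filter_upwards [h1] with t ht
      have h5 : HasDerivAt (fun t : ℝ => k / 2 * (‖w‖ ^ 2 + 2 * t * w i + t ^ 2))
          (k * (w i + t)) t := by
        have := (((((hasDerivAt_id t).const_mul 2).mul_const (w i)).const_add (‖w‖ ^ 2)).add
          (hasDerivAt_pow 2 t)).const_mul (k / 2)
        refine this.congr_deriv ?_
        simp; ring
      exact h5.sub ht
    · have h5 : HasDerivAt (fun t : ℝ => k * (w i + t)) k 0 := by
        simpa using ((hasDerivAt_id (0:ℝ)).const_add (w i)).const_mul k
      exact h5.sub h2
    · have hc : ContinuousAt (fun t : ℝ => w + t • EuclideanSpace.single i (1:ℝ)) 0 := by fun_prop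
      have hb : Metric.closedBall (0 : EuclideanSpace ℝ (Fin n)) 1 ∈
          𝓝 (w + (0:ℝ) • EuclideanSpace.single i (1:ℝ)) := by
        simp only [zero_smul, add_zero]
        exact mem_of_superset (Metric.isOpen_ball.mem_nhds (by simpa using hwlt))
          Metric.ball_subset_closedBall
      filter_upwards [hc.preimage_mem_nhds hb] with t ht
      have h6 : Q (w + t • EuclideanSpace.single i (1:ℝ)) ≤ Q w := hmax ht
      simp only [hQ, hline, hnorm, ← hv] at h6
      simp only [zero_smul, add_zero, mul_zero, zero_mul, ne_eq, OfNat.ofNat_ne_zero,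
        not_false_eq_true, zero_pow]
      linarith
  linarith

lemma aux_U {n : ℕ} (i0 : Fin n) (δ r : ℝ) (hδ : 0 < δ) (hr : 0 < r) :
    {x : EuclideanSpace ℝ (Fin n) | 0 < x i0 ∧ x i0 < r / 2 ∧
      ‖x - EuclideanSpace.single i0 (x i0)‖ < δ / 2} ⊆
    interior (convexHull ℝ (closure {x : EuclideanSpace ℝ (Fin n) | x i0 = 0 ∧ ‖x‖ < δ} ∪
              {r • EuclideanSpace.single i0 (1:ℝ)})) := by
  refine interior_maximal ?_ ?_
  · rintro x ⟨h1, h2, h3⟩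
    have hs : x i0 / r < 1 / 2 := by rw [div_lt_iff₀ hr]; linarith
    have hs0 : 0 < x i0 / r := by positivity
    set s := x i0 / r with hsd
    set y : EuclideanSpace ℝ (Fin n) := (1 - s)⁻¹ • (x - EuclideanSpace.single i0 (x i0)) with hy
    have hyd : y ∈ {x : EuclideanSpace ℝ (Fin n) | x i0 = 0 ∧ ‖x‖ < δ} := by
      refine ⟨by simp [hy], ?_⟩
      rw [hy, norm_smul, norm_inv, Real.norm_of_nonneg (by linarith),
        inv_mul_lt_iff₀ (by linarith)]
      nlinarith
    have hx : x = (1 - s) • y + s • (r • EuclideanSpace.single i0 (1:ℝ)) := by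
      rw [hy, smul_smul, mul_inv_cancel₀ (by linarith), one_smul, smul_smul, hsd,
        div_mul_cancel₀ _ hr.ne']
      ext j
      by_cases h : j = i0
      · subst h; simp
      · simp [h]
    have hmem := (convex_convexHull ℝ (closure {x : EuclideanSpace ℝ (Fin n) | x i0 = 0 ∧ ‖x‖ < δ} ∪
              {r • EuclideanSpace.single i0 (1:ℝ)}))
      (subset_convexHull ℝ _ (Or.inl (subset_closure hyd)))
      (subset_convexHull ℝ _ (Or.inr (Set.mem_singleton _)))
      (show 0 ≤ 1 - s by linarith) hs0.le (by ring)
    rw [← hx] at hmem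
    exact hmem
  · have hc : Continuous fun x : EuclideanSpace ℝ (Fin n) => x i0 := by fun_prop
    have hc2 : Continuous fun x : EuclideanSpace ℝ (Fin n) =>
        ‖x - EuclideanSpace.single i0 (x i0)‖ := by
      have : (fun x : EuclideanSpace ℝ (Fin n) => EuclideanSpace.single i0 (x i0)) =
        fun x => (x i0) • EuclideanSpace.single i0 (1:ℝ) := by
        ext x j; by_cases h : j = i0
        · subst h; simp
        · simp [h]
      have h2 : Continuous (fun x : EuclideanSpace ℝ (Fin n) => EuclideanSpace.single i0 (x i0)) := by
        rw [this]; fun_prop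
      exact (continuous_id.sub h2).norm
    exact (isOpen_lt continuous_const hc).inter
      ((isOpen_lt hc continuous_const).inter (isOpen_lt hc2 continuous_const))

lemma aux_main_s14 {n : ℕ} (hn : 2 ≤ n) (i0 : Fin n) (δ r lam bb : ℝ)
    (u : EuclideanSpace ℝ (Fin n) → ℝ) (hδ : 0 < δ) (hr : 0 < r) (hl : 0 < lam) (hb : 0 ≤ bb)
    (K : Set (EuclideanSpace ℝ (Fin n)))
    (hKdef : K = convexHull ℝ
            (closure {x : EuclideanSpace ℝ (Fin n) | x i0 = 0 ∧ ‖x‖ < δ} ∪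
              {r • EuclideanSpace.single i0 (1:ℝ)}))
    (hK : ConvexOn ℝ K u) (h0 : ∀ x ∈ K, 0 ≤ u x) (hC : ContDiffOn ℝ 2 u (interior K))
    (hdet : ∀ x ∈ interior K, lam ≤ (hess u x).det)
    (hbb : ∀ x ∈ closure {x : EuclideanSpace ℝ (Fin n) | x i0 = 0 ∧ ‖x‖ < δ}, u x ≤ bb) :
    (128:ℝ)⁻¹ * lam ^ ((1:ℝ)/n) * δ ^ (2 * ((n:ℝ) - 1) / n) * r ^ ((2:ℝ)/n)
          ≤ max bb (u (r • EuclideanSpace.single i0 (1:ℝ))) := by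
  set M := max bb (u (r • EuclideanSpace.single i0 (1:ℝ))) with hMd
  have hn' : (0:ℝ) < n := by exact_mod_cast (by omega : 0 < n)
  have hM0 : 0 ≤ M := hb.trans (le_max_left _ _)
  have hgen : closure {x : EuclideanSpace ℝ (Fin n) | x i0 = 0 ∧ ‖x‖ < δ} ∪
              {r • EuclideanSpace.single i0 (1:ℝ)} ⊆ K := by
    rw [hKdef]; exact subset_convexHull ℝ _
  have hM : ∀ x ∈ K, u x ≤ M := by
    have : K ⊆ {x ∈ K | u x ≤ M} := by
      conv_lhs => rw [hKdef]
      refine convexHull_min ?_ (hK.convex_le M)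
      intro x hx
      refine ⟨hgen hx, ?_⟩
      rcases hx with hx | hx
      · exact (hbb x hx).trans (le_max_left _ _)
      · rw [Set.mem_singleton_iff.1 hx]; exact le_max_right _ _
    exact fun x hx => (this hx).2
  set a : Fin n → ℝ := fun i => if i = i0 then r / 8 else δ / 8 with ha
  have hT : ∀ w : EuclideanSpace ℝ (Fin n), ‖w‖ ≤ 1 →
      EuclideanSpace.single i0 (r / 4) + WithLp.toLp 2 (fun i => a i * w i) ∈ interior K := by
    intro w hw
    rw [hKdef]
    refine aux_U i0 δ r hδ hr ?_
    have hwi : |w i0| ≤ 1 := by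
      have := PiLp.norm_apply_le w i0
      rw [Real.norm_eq_abs] at this
      linarith
    obtain ⟨hw1, hw2⟩ := abs_le.1 hwi
    refine ⟨?_, ?_, ?_⟩
    · simp [ha]; nlinarith
    · simp [ha]; nlinarith
    · have hle : ‖EuclideanSpace.single i0 (r / 4) + WithLp.toLp 2 (fun i => a i * w i) -
          EuclideanSpace.single i0 ((EuclideanSpace.single i0 (r / 4) +
            WithLp.toLp 2 (fun i => a i * w i) : EuclideanSpace ℝ (Fin n)) i0)‖
          ≤ ‖(δ / 8) • w‖ := by
        rw [EuclideanSpace.norm_eq, EuclideanSpace.norm_eq]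
        refine Real.sqrt_le_sqrt (Finset.sum_le_sum fun j _ => ?_)
        by_cases h : j = i0
        · subst h; simp; positivity
        · simp [h, ha]
      refine hle.trans_lt ?_
      rw [norm_smul, Real.norm_of_nonneg (by positivity)]
      nlinarith
  have hprod : ∏ i, a i = r * δ ^ (n - 1) / 8 ^ n := by
    simp only [ha]
    rw [Finset.prod_ite]
    simp only [Finset.prod_const]
    have e1 : (Finset.univ.filter fun i : Fin n => i = i0).card = 1 := by
      rw [Finset.filter_eq']; simp
    have e2 : (Finset.univ.filter fun i : Fin n => ¬ i = i0).card = n - 1 := by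
      rw [Finset.filter_ne']; simp [Finset.card_erase_of_mem]
    rw [e1, e2]
    obtain ⟨m, rfl⟩ : ∃ m, n = m + 1 := ⟨n - 1, by omega⟩
    simp only [Nat.add_sub_cancel]
    rw [div_pow, div_pow, pow_succ]; ring
  by_contra hcon
  push Not at hcon
  set k0 := 2 * ((128:ℝ)⁻¹ * lam ^ ((1:ℝ)/n) * δ ^ (2 * ((n:ℝ) - 1) / n) * r ^ ((2:ℝ)/n)) with hk0
  have hk0n : k0 ^ n = (∏ i, a i) ^ 2 * lam := by
    have p1 : (lam ^ ((1:ℝ)/n)) ^ n = lam := by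
      rw [← Real.rpow_mul_natCast hl.le, div_mul_cancel₀ _ hn'.ne', Real.rpow_one]
    have p2 : (δ ^ (2 * ((n:ℝ) - 1) / n)) ^ n = (δ ^ (n - 1)) ^ 2 := by
      rw [← Real.rpow_mul_natCast hδ.le, div_mul_cancel₀ _ hn'.ne', ← pow_mul,
        ← Real.rpow_natCast]
      congr 1
      rw [Nat.cast_mul, Nat.cast_sub (by omega)]
      push_cast; ring
    have p3 : (r ^ ((2:ℝ)/n)) ^ n = r ^ 2 := by
      rw [← Real.rpow_mul_natCast hr.le, div_mul_cancel₀ _ hn'.ne']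
      exact Real.rpow_natCast r 2
    have e : k0 = (64:ℝ)⁻¹ * lam ^ ((1:ℝ)/n) * δ ^ (2 * ((n:ℝ) - 1) / n) * r ^ ((2:ℝ)/n) := by
      rw [hk0]; ring
    rw [e, mul_pow, mul_pow, mul_pow, p1, p2, p3, hprod, inv_pow,
      show (64:ℝ) = 8 ^ 2 by norm_num, ← pow_mul, mul_comm 2 n, pow_mul]
    field_simp
  obtain ⟨k, hk1, hk2⟩ := exists_between (show 2 * M < k0 by rw [hk0]; linarith)
  have := aux_core (by omega) K u hK _ a M k lam hT hC hdet h0 hM hk1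
  have h9 : k ^ n < k0 ^ n := pow_lt_pow_left₀ hk2 (by linarith) (by omega)
  linarith

/-- Lemma A (Caffarelli–Li): a nonnegative convex function on the convex hull of a
flat disc and a far-away point, whose Monge–Ampère measure is bounded below,
cannot stay small both on the disc and at the point. -/
theorem caffarelli_li_lemma_A
    (n : ℕ) (hn : 2 ≤ n) :
    ∃ C : ℝ, 1 < C ∧
      ∀ (δ r lam bb : ℝ) (u : EuclideanSpace ℝ (Fin n) → ℝ),
        0 < δ → 0 < r → 0 < lam → 0 ≤ bb →
        (ContinuousOn u (convexHull ℝ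
            (closure {x : EuclideanSpace ℝ (Fin n) | x ⟨0, by omega⟩ = 0 ∧ ‖x‖ < δ} ∪
              {r • EuclideanSpace.single (⟨0, by omega⟩ : Fin n) (1:ℝ)}))) →
        (ConvexOn ℝ (convexHull ℝ
            (closure {x : EuclideanSpace ℝ (Fin n) | x ⟨0, by omega⟩ = 0 ∧ ‖x‖ < δ} ∪
              {r • EuclideanSpace.single (⟨0, by omega⟩ : Fin n) (1:ℝ)})) u) →
        (∀ x ∈ convexHull ℝ
            (closure {x : EuclideanSpace ℝ (Fin n) | x ⟨0, by omega⟩ = 0 ∧ ‖x‖ < δ} ∪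
              {r • EuclideanSpace.single (⟨0, by omega⟩ : Fin n) (1:ℝ)}), 0 ≤ u x) →
        (ContDiffOn ℝ 2 u (interior (convexHull ℝ
            (closure {x : EuclideanSpace ℝ (Fin n) | x ⟨0, by omega⟩ = 0 ∧ ‖x‖ < δ} ∪
              {r • EuclideanSpace.single (⟨0, by omega⟩ : Fin n) (1:ℝ)})))) →
        (∀ x ∈ interior (convexHull ℝ
            (closure {x : EuclideanSpace ℝ (Fin n) | x ⟨0, by omega⟩ = 0 ∧ ‖x‖ < δ} ∪
              {r • EuclideanSpace.single (⟨0, by omega⟩ : Fin n) (1:ℝ)})),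
            lam ≤ (hess u x).det) →
        (∀ x ∈ closure {x : EuclideanSpace ℝ (Fin n) | x ⟨0, by omega⟩ = 0 ∧ ‖x‖ < δ},
            u x ≤ bb) →
        C⁻¹ * lam ^ ((1:ℝ)/n) * δ ^ (2 * ((n:ℝ) - 1) / n) * r ^ ((2:ℝ)/n)
          ≤ max bb (u (r • EuclideanSpace.single (⟨0, by omega⟩ : Fin n) (1:ℝ))) := by

  refine ⟨128, by norm_num, ?_⟩
  intro δ r lam bb u hδ hr hl hb _ hK h0 hC hdet hbb
  exact aux_main_s14 hn _ δ r lam bb u hδ hr hl hb _ rfl hK h0 hC hdet hbb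
end

section
/- There is a universal constant C > 0 with the following property. Let g : (−1,1) → ℝ be twice continuously differentiable, strictly convex, and bounded; let 0 < ε ≤ 1/4 and let h ∈ ℝ with 0 < |h| ≤ ε. Then: (i) Δ²_h g(x) := (g(x+h) + g(x−h) − 2g(x))/h² > 0 for all x with |x| ≤ 1−2ε; and (ii) ∫_{−1+2ε}^{1−2ε} Δ²_h g(x) dx ≤ (C/ε) · osc_{(−1,1)} g, where osc_{(−1,1)} g = sup_{(−1,1)} g − inf_{(−1,1)} g. -/
open MeasureTheory intervalIntegral

theorem aux_B (g : ℝ → ℝ) (ε h M : ℝ) (hc : ContinuousOn g (Set.Ioo (-1:ℝ) 1))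
    (hg : StrictConvexOn ℝ (Set.Ioo (-1:ℝ) 1) g)
    (hM : ∀ x ∈ Set.Ioo (-1:ℝ) 1, ∀ y ∈ Set.Ioo (-1:ℝ) 1, g x - g y ≤ M)
    (he : 0 < ε) (he4 : ε ≤ 1/4) (h0 : 0 < h) (hh : h ≤ ε) :
    (∀ x : ℝ, |x| ≤ 1 - 2*ε → 0 < (g (x + h) + g (x - h) - 2 * g x) / h ^ 2) ∧
    (∫ x in (-1 + 2*ε)..(1 - 2*ε), (g (x + h) + g (x - h) - 2 * g x) / h ^ 2)
          ≤ (4 / ε) * M := by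
  constructor
  · intro x hx
    obtain ⟨h1, h2⟩ := abs_le.mp hx
    have := hg.slope_strict_mono_adjacent (x := x - h) (y := x) (z := x + h)
      ⟨by linarith, by linarith⟩ ⟨by linarith, by linarith⟩ (by linarith) (by linarith)
    rw [show x - (x - h) = h by ring, show x + h - x = h by ring,
      div_lt_div_iff_of_pos_right h0] at this
    apply div_pos _ (by positivity)
    linarith
  · have hup : ∀ x, -1 + ε ≤ x - h → x ≤ 1 - ε → g x - g (x - h) ≤ 2 / ε * M * h := by
      intro x h1 h2
      have hs := (hg.slope_strict_mono_adjacent (x := x - h) (y := x) (z := x + ε/2)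
        ⟨by linarith, by linarith⟩ ⟨by linarith, by linarith⟩ (by linarith) (by linarith)).le
      have hm := hM (x + ε/2) ⟨by linarith, by linarith⟩ x ⟨by linarith, by linarith⟩
      rw [show x - (x - h) = h by ring, show x + ε/2 - x = ε/2 by ring, div_le_iff₀ h0] at hs
      refine hs.trans ?_
      have : (g (x + ε/2) - g x) / (ε/2) ≤ 2 / ε * M := by
        rw [div_le_iff₀ (by linarith)]
        have : 2 / ε * M * (ε/2) = M := by field_simp
        linarith
      exact mul_le_mul_of_nonneg_right this h0.le
    have hlo : ∀ x, -1 + ε ≤ x - h → x ≤ 1 - ε → -(2 / ε * M * h) ≤ g x - g (x - h) := by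
      intro x h1 h2
      have hs := (hg.slope_strict_mono_adjacent (x := x - h - ε/2) (y := x - h) (z := x)
        ⟨by linarith, by linarith⟩ ⟨by linarith, by linarith⟩ (by linarith) (by linarith)).le
      have hm := hM (x - h - ε/2) ⟨by linarith, by linarith⟩ (x-h) ⟨by linarith, by linarith⟩
      rw [show x - (x - h) = h by ring, show x - h - (x - h - ε/2) = ε/2 by ring,
        le_div_iff₀ h0] at hs
      refine le_trans ?_ hs
      have : -(2 / ε * M) ≤ (g (x - h) - g (x - h - ε/2)) / (ε/2) := by
        rw [le_div_iff₀ (by linarith)]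
        have : -(2 / ε * M) * (ε/2) = -M := by field_simp
        linarith
      have := mul_le_mul_of_nonneg_right this h0.le
      linarith
    set D : ℝ → ℝ := fun x => g x - g (x - h) with hD
    have hDc : ContinuousOn D (Set.Icc (-1 + 2*ε) (1 - 2*ε + h)) := by
      apply ContinuousOn.sub
      · exact hc.mono fun x hx => ⟨by linarith [hx.1], by linarith [hx.2]⟩
      · exact hc.comp (by fun_prop) fun x hx => ⟨by linarith [hx.1], by linarith [hx.2]⟩
    have hI : ∀ a b, a ∈ Set.Icc (-1 + 2*ε) (1 - 2*ε + h) →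
        b ∈ Set.Icc (-1 + 2*ε) (1 - 2*ε + h) → IntervalIntegrable D volume a b := by
      intro a b ha hb
      apply ContinuousOn.intervalIntegrable
      exact hDc.mono (Set.uIcc_subset_Icc ha hb)
    have m1 : (-1 + 2*ε) ∈ Set.Icc (-1 + 2*ε) (1 - 2*ε + h) := ⟨by linarith, by linarith⟩
    have m2 : (-1 + 2*ε + h) ∈ Set.Icc (-1 + 2*ε) (1 - 2*ε + h) := ⟨by linarith, by linarith⟩
    have m3 : (1 - 2*ε) ∈ Set.Icc (-1 + 2*ε) (1 - 2*ε + h) := ⟨by linarith, by linarith⟩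
    have m4 : (1 - 2*ε + h) ∈ Set.Icc (-1 + 2*ε) (1 - 2*ε + h) := ⟨by linarith, by linarith⟩
    have e1 : (∫ x in (-1 + 2*ε)..(1 - 2*ε), (g (x + h) + g (x - h) - 2 * g x) / h ^ 2)
        = ((∫ x in (-1 + 2*ε)..(1 - 2*ε), D (x + h)) - ∫ x in (-1 + 2*ε)..(1 - 2*ε), D x)
          / h ^ 2 := by
      rw [intervalIntegral.integral_div, ← intervalIntegral.integral_sub]
      · congr 2
        ext x
        simp only [hD, add_sub_cancel_right]
        ring
      · have := (hI _ _ m2 m4).comp_add_right h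
        simpa using this
      · exact hI _ _ m1 m3
    rw [e1, intervalIntegral.integral_comp_add_right (fun x => D x),
      intervalIntegral.integral_interval_sub_interval_comm (hI _ _ m2 m4) (hI _ _ m1 m3)
        (hI _ _ m2 m1), intervalIntegral.integral_symm (-1 + 2*ε),
      intervalIntegral.integral_symm (1 - 2*ε)]
    have b1 : ∫ x in (1 - 2*ε)..(1 - 2*ε + h), D x ≤ 2 / ε * M * h * h := by
      have := intervalIntegral.integral_mono_on (by linarith) (hI _ _ m3 m4)
        (intervalIntegrable_const (c := 2 / ε * M * h))
        (fun x hx => hup x (by linarith [hx.1]) (by linarith [hx.2]))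
      simp only [intervalIntegral.integral_const, smul_eq_mul] at this
      linarith
    have b2 : -(2 / ε * M * h * h) ≤ ∫ x in (-1 + 2*ε)..(-1 + 2*ε + h), D x := by
      have := intervalIntegral.integral_mono_on (by linarith)
        (intervalIntegrable_const (c := -(2 / ε * M * h))) (hI _ _ m1 m2)
        (fun x hx => hlo x (by linarith [hx.1]) (by linarith [hx.2]))
      simp only [intervalIntegral.integral_const, smul_eq_mul] at this
      linarith
    rw [div_le_iff₀ (by positivity)]
    have : 4 / ε * M * h ^ 2 = 2 / ε * M * h * h + 2 / ε * M * h * h := by ring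
    linarith

/-- Lemma B (Caffarelli–Li): second-order incremental quotients of a bounded
strictly convex function on `(-1,1)` are positive on `[-1+2ε, 1-2ε]` and their
integral there is controlled by `(C/ε) · osc g`. -/
theorem caffarelli_li_lemma_B :
    ∃ C : ℝ, 0 < C ∧
      ∀ (g : ℝ → ℝ) (ε h : ℝ),
        ContDiffOn ℝ 2 g (Set.Ioo (-1:ℝ) 1) →
        StrictConvexOn ℝ (Set.Ioo (-1:ℝ) 1) g →
        BddAbove (g '' Set.Ioo (-1:ℝ) 1) →
        BddBelow (g '' Set.Ioo (-1:ℝ) 1) →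
        0 < ε → ε ≤ 1/4 → 0 < |h| → |h| ≤ ε →
        (∀ x : ℝ, |x| ≤ 1 - 2*ε →
            0 < (g (x + h) + g (x - h) - 2 * g x) / h ^ 2) ∧
        (∫ x in (-1 + 2*ε)..(1 - 2*ε), (g (x + h) + g (x - h) - 2 * g x) / h ^ 2)
          ≤ (C / ε) * (sSup (g '' Set.Ioo (-1:ℝ) 1) - sInf (g '' Set.Ioo (-1:ℝ) 1)) := by
  refine ⟨4, by norm_num, ?_⟩
  intro g ε h hc hg ha hb he he4 h0 hh
  have hM : ∀ x ∈ Set.Ioo (-1:ℝ) 1, ∀ y ∈ Set.Ioo (-1:ℝ) 1, g x - g y ≤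
      sSup (g '' Set.Ioo (-1:ℝ) 1) - sInf (g '' Set.Ioo (-1:ℝ) 1) := fun x hx y hy =>
    sub_le_sub (le_csSup ha ⟨x, hx, rfl⟩) (csInf_le hb ⟨y, hy, rfl⟩)
  have key := aux_B g ε |h| _ hc.continuousOn hg hM he he4 h0 hh
  rcases abs_choice h with h1 | h1
  · rwa [h1] at key
  · rw [h1] at key
    have e : ∀ x, (g (x + -h) + g (x - -h) - 2 * g x) / (-h) ^ 2
        = (g (x + h) + g (x - h) - 2 * g x) / h ^ 2 := by
      intro x
      rw [sub_neg_eq_add, ← sub_eq_add_neg, neg_sq, add_comm (g (x - h))]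
    simpa only [e] using key
end

section
/- Let g_i : [−1,1] → ℝ be a sequence of continuously differentiable functions converging to g in C¹([−1,1]) (i.e., g_i → g and g_i' → g' uniformly on [−1,1]), where g is twice continuously differentiable on (−1,1). Let (h_i) be a sequence of nonzero reals with h_i → 0, and let −1 < a < b < 1. Then lim_{i→∞} ∫_a^b (g_i(x+h_i) + g_i(x−h_i) − 2g_i(x))/h_i² dx = g'(b) − g'(a) = ∫_a^b g''(x) dx. -/
open MeasureTheory intervalIntegral Filter

lemma aux_int (f : ℝ → ℝ) (hf : ContinuousOn f (Set.Icc (-1:ℝ) 1)) {p q : ℝ}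
    (hp : p ∈ Set.Icc (-1:ℝ) 1) (hq : q ∈ Set.Icc (-1:ℝ) 1) :
    IntervalIntegrable f volume p q :=
  (hf.mono (Set.uIcc_subset_Icc hp hq)).intervalIntegrable

lemma aux_E (f : ℝ → ℝ) (hf : ContDiffOn ℝ 1 f (Set.Icc (-1:ℝ) 1)) (c h L ε : ℝ)
    (hc1 : -1 ≤ c - |h|) (hc2 : c + |h| ≤ 1)
    (hd : ∀ x ∈ Set.Icc (c - |h|) (c + |h|),
      |derivWithin f (Set.Icc (-1:ℝ) 1) x - L| ≤ ε) :
    |((∫ x in c..(c+h), f x) - ∫ x in (c-h)..c, f x) - h ^ 2 * L| ≤ ε * h ^ 2 := by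
  have hle := le_abs_self h
  have hnle := neg_abs_le h
  have h0 := abs_nonneg h
  have hsub : Set.Icc (c - |h|) (c + |h|) ⊆ Set.Icc (-1:ℝ) 1 := Set.Icc_subset_Icc hc1 hc2
  have key : ∀ x ∈ Set.Icc (c - |h|) (c + |h|), ∀ y ∈ Set.Icc (c - |h|) (c + |h|),
      ‖(f y - L * y) - (f x - L * x)‖ ≤ ε * ‖y - x‖ := by
    intro x hx y hy
    refine Convex.norm_image_sub_le_of_norm_hasDerivWithin_le
      (f := fun x => f x - L * x) (f' := fun x => derivWithin f (Set.Icc (-1:ℝ) 1) x - L)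
      (s := Set.Icc (c - |h|) (c + |h|)) ?_ (fun z hz => hd z hz) (convex_Icc _ _) hx hy
    intro z hz
    have h1 := ((hf.differentiableOn (by norm_num)) z (hsub hz)).hasDerivWithinAt.mono hsub
    have h2 := ((hasDerivAt_id z).const_mul L).hasDerivWithinAt (s := Set.Icc (c - |h|) (c + |h|))
    have h3 := h1.sub h2
    rw [mul_one] at h3
    exact h3
  have i1 : IntervalIntegrable f volume (c - h) c :=
    aux_int f hf.continuousOn ⟨by linarith, by linarith⟩ ⟨by linarith, by linarith⟩
  have i2 : IntervalIntegrable f volume c (c + h) :=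
    aux_int f hf.continuousOn ⟨by linarith, by linarith⟩ ⟨by linarith, by linarith⟩
  have i3 : IntervalIntegrable (fun x => f (x + h)) volume (c - h) c := by
    simpa using i2.comp_add_right h
  have e : ((∫ x in c..(c+h), f x) - ∫ x in (c-h)..c, f x) - h ^ 2 * L
      = ∫ x in (c-h)..c, (f (x + h) - f x - h * L) := by
    rw [intervalIntegral.integral_sub (i3.sub i1) (by simp),
      intervalIntegral.integral_sub i3 i1, intervalIntegral.integral_comp_add_right f h]
    simp
    ring
  rw [e]
  have := intervalIntegral.norm_integral_le_of_norm_le_const (a := c - h) (b := c)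
    (f := fun x => f (x + h) - f x - h * L) (C := ε * |h|) ?_
  · calc _ ≤ _ := this
      _ = ε * h ^ 2 := by rw [← sq_abs h, sub_sub_cancel]; ring
  · intro x hx
    have hx' := Set.uIoc_subset_uIcc hx
    rw [Set.mem_uIcc] at hx'
    have hx1 : x ∈ Set.Icc (c - |h|) (c + |h|) := by
      rcases hx' with h' | h' <;> constructor <;> linarith [h'.1, h'.2]
    have hx2 : x + h ∈ Set.Icc (c - |h|) (c + |h|) := by
      rcases hx' with h' | h' <;> constructor <;> linarith [h'.1, h'.2]
    have := key x hx1 (x + h) hx2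
    have e2 : (f (x + h) - L * (x + h)) - (f x - L * x) = f (x + h) - f x - h * L := by ring
    rw [e2] at this
    simpa using this

lemma aux_split (f : ℝ → ℝ) (hf : ContinuousOn f (Set.Icc (-1:ℝ) 1)) (a b h : ℝ)
    (ha1 : -1 ≤ a - |h|) (ha2 : a + |h| ≤ 1) (hb1 : -1 ≤ b - |h|) (hb2 : b + |h| ≤ 1) :
    (∫ x in a..b, (f (x + h) + f (x - h) - 2 * f x) / h ^ 2) =
      ((∫ x in b..(b+h), f x) - ∫ x in (b-h)..b, f x) / h ^ 2
      - ((∫ x in a..(a+h), f x) - ∫ x in (a-h)..a, f x) / h ^ 2 := by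
  have hle := le_abs_self h
  have hnle := neg_abs_le h
  have h0 := abs_nonneg h
  have ma : a ∈ Set.Icc (-1:ℝ) 1 := ⟨by linarith, by linarith⟩
  have mb : b ∈ Set.Icc (-1:ℝ) 1 := ⟨by linarith, by linarith⟩
  have map : a + h ∈ Set.Icc (-1:ℝ) 1 := ⟨by linarith, by linarith⟩
  have mbp : b + h ∈ Set.Icc (-1:ℝ) 1 := ⟨by linarith, by linarith⟩
  have mam : a - h ∈ Set.Icc (-1:ℝ) 1 := ⟨by linarith, by linarith⟩
  have mbm : b - h ∈ Set.Icc (-1:ℝ) 1 := ⟨by linarith, by linarith⟩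
  have m0 : (0:ℝ) ∈ Set.Icc (-1:ℝ) 1 := ⟨by norm_num, by norm_num⟩
  have I : ∀ p ∈ Set.Icc (-1:ℝ) 1, ∀ q ∈ Set.Icc (-1:ℝ) 1,
      (∫ x in p..q, f x) = (∫ x in (0:ℝ)..q, f x) - ∫ x in (0:ℝ)..p, f x := by
    intro p hp q hq
    rw [intervalIntegral.integral_interval_sub_left (aux_int f hf m0 hq) (aux_int f hf m0 hp)]
  have i1 : IntervalIntegrable (fun x => f (x + h)) volume a b := by
    simpa using (aux_int f hf map mbp).comp_add_right h
  have i2 : IntervalIntegrable (fun x => f (x - h)) volume a b := by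
    simpa using (aux_int f hf mam mbm).comp_sub_right h
  have i3 := aux_int f hf ma mb
  rw [intervalIntegral.integral_div, intervalIntegral.integral_sub (i1.add i2) (i3.const_mul 2),
    intervalIntegral.integral_add i1 i2, intervalIntegral.integral_const_mul,
    intervalIntegral.integral_comp_add_right f h, intervalIntegral.integral_comp_sub_right f h,
    I _ map _ mbp, I _ mam _ mbm, I _ ma _ mb, I _ mb _ mbp, I _ mbm _ mb, I _ ma _ map,
    I _ mam _ ma]
  ring

lemma aux_lim (gs : ℕ → ℝ → ℝ) (g : ℝ → ℝ)
    (hgs : ∀ i, ContDiffOn ℝ 1 (gs i) (Set.Icc (-1:ℝ) 1))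
    (hg1 : ContDiffOn ℝ 1 g (Set.Icc (-1:ℝ) 1))
    (hconv' : TendstoUniformlyOn
        (fun i x => derivWithin (gs i) (Set.Icc (-1:ℝ) 1) x)
        (fun x => derivWithin g (Set.Icc (-1:ℝ) 1) x) atTop (Set.Icc (-1:ℝ) 1))
    (h : ℕ → ℝ) (hh0 : ∀ i, h i ≠ 0) (hh : Tendsto h atTop (nhds 0))
    (c : ℝ) (hc1 : -1 < c) (hc2 : c < 1) :
    Tendsto (fun i => ((∫ x in c..(c+h i), gs i x) - ∫ x in (c-h i)..c, gs i x) / (h i) ^ 2)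
      atTop (nhds (deriv g c)) := by
  have hD : derivWithin g (Set.Icc (-1:ℝ) 1) c = deriv g c :=
    derivWithin_of_mem_nhds (Icc_mem_nhds hc1 hc2)
  have hcont : ContinuousAt (fun x => derivWithin g (Set.Icc (-1:ℝ) 1) x) c :=
    (hg1.continuousOn_derivWithin (uniqueDiffOn_Icc (by norm_num)) (by norm_num)).continuousAt
      (Icc_mem_nhds hc1 hc2)
  rw [Metric.tendsto_nhds]
  intro ε hε
  obtain ⟨δ, hδ, hδ'⟩ := Metric.continuousAt_iff.1 hcont (ε / 4) (by positivity)
  have hu := Metric.tendstoUniformlyOn_iff.1 hconv' (ε / 4) (by positivity)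
  have hsm : ∀ r > 0, ∀ᶠ i in atTop, |h i| < r := by
    intro r hr
    filter_upwards [Metric.tendsto_nhds.1 hh r hr] with i hi
    simpa using hi
  filter_upwards [hu, hsm δ hδ, hsm (c + 1) (by linarith), hsm (1 - c) (by linarith)]
    with i hi h1 h2 h3
  have hE := aux_E (gs i) (hgs i) c (h i) (deriv g c) (ε / 2) (by linarith) (by linarith) (by
    intro x hx
    have hx1 := hi x ⟨by linarith [hx.1], by linarith [hx.2]⟩
    have hx2 := @hδ' x (by
      rw [Real.dist_eq, abs_lt]; constructor <;> linarith [hx.1, hx.2])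
    rw [Real.dist_eq, abs_lt] at hx1 hx2
    rw [hD] at hx2
    rw [abs_le]
    constructor <;> linarith [hx1.1, hx1.2, hx2.1, hx2.2])
  have hpos : 0 < (h i) ^ 2 := by have := hh0 i; positivity
  rw [Real.dist_eq]
  have e : ((∫ x in c..(c+h i), gs i x) - ∫ x in (c-h i)..c, gs i x) / (h i) ^ 2 - deriv g c
      = (((∫ x in c..(c+h i), gs i x) - ∫ x in (c-h i)..c, gs i x) - (h i) ^ 2 * deriv g c)
        / (h i) ^ 2 := by
    rw [sub_div _ ((h i) ^ 2 * deriv g c), mul_div_cancel_left₀ _ hpos.ne']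
  rw [e, abs_div, abs_of_pos hpos, div_lt_iff₀ hpos]
  nlinarith

/-- Lemma C (Caffarelli–Li): if `gᵢ → g` in `C¹([-1,1])`, `g` is `C²` on `(-1,1)`,
and `hᵢ → 0` with `hᵢ ≠ 0`, then the integrals of the second-order incremental
quotients `Δ²_{hᵢ} gᵢ` over `[a,b] ⊂ (-1,1)` converge to `g'(b) - g'(a) = ∫_a^b g''`. -/
theorem caffarelli_li_lemma_C
    (gs : ℕ → ℝ → ℝ) (g : ℝ → ℝ)
    (hgs : ∀ i, ContDiffOn ℝ 1 (gs i) (Set.Icc (-1:ℝ) 1))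
    (hg1 : ContDiffOn ℝ 1 g (Set.Icc (-1:ℝ) 1))
    (hg2 : ContDiffOn ℝ 2 g (Set.Ioo (-1:ℝ) 1))
    (hconv : TendstoUniformlyOn (fun i => gs i) g atTop (Set.Icc (-1:ℝ) 1))
    (hconv' : TendstoUniformlyOn
        (fun i x => derivWithin (gs i) (Set.Icc (-1:ℝ) 1) x)
        (fun x => derivWithin g (Set.Icc (-1:ℝ) 1) x) atTop (Set.Icc (-1:ℝ) 1))
    (h : ℕ → ℝ) (hh0 : ∀ i, h i ≠ 0) (hh : Tendsto h atTop (nhds 0))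
    (a b : ℝ) (ha : -1 < a) (hab : a < b) (hb : b < 1) :
    Tendsto (fun i => ∫ x in a..b,
        (gs i (x + h i) + gs i (x - h i) - 2 * gs i x) / (h i) ^ 2)
      atTop (nhds (deriv g b - deriv g a)) ∧
    deriv g b - deriv g a = ∫ x in a..b, deriv (deriv g) x := by
  constructor
  · have la := aux_lim gs g hgs hg1 hconv' h hh0 hh a ha (hab.trans hb)
    have lb := aux_lim gs g hgs hg1 hconv' h hh0 hh b (ha.trans hab) hb
    refine (lb.sub la).congr' ?_
    have hsm : ∀ r > 0, ∀ᶠ i in atTop, |h i| < r := by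
      intro r hr
      filter_upwards [Metric.tendsto_nhds.1 hh r hr] with i hi
      simpa using hi
    filter_upwards [hsm (a + 1) (by linarith), hsm (1 - b) (by linarith)] with i h1 h2
    exact (aux_split (gs i) (hgs i).continuousOn a b (h i) (by linarith) (by linarith)
      (by linarith) (by linarith)).symm
  · have hsub : Set.uIcc a b ⊆ Set.Ioo (-1:ℝ) 1 := by
      rw [Set.uIcc_of_le hab.le]
      exact fun x hx => ⟨by linarith [hx.1], by linarith [hx.2]⟩
    have hd : ContDiffOn ℝ 1 (deriv g) (Set.Ioo (-1:ℝ) 1) :=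
      hg2.deriv_of_isOpen isOpen_Ioo (by norm_num)
    have hdd : ContinuousOn (deriv (deriv g)) (Set.Ioo (-1:ℝ) 1) :=
      hd.continuousOn_deriv_of_isOpen isOpen_Ioo (by norm_num)
    refine (intervalIntegral.integral_eq_sub_of_hasDerivAt (fun x hx => ?_)
      (hdd.mono hsub).intervalIntegrable).symm
    exact ((hd.differentiableOn (by norm_num)).differentiableAt
      (isOpen_Ioo.mem_nhds (hsub hx))).hasDerivAt
end
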